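/- Let Γ be a subgroup of Diff^ω₊(S¹) which is nondiscrete with respect to the C¹-topology. Then Γ has a finite image under the rotation number function if and only if Γ has a finite orbit. -/

import Mathlib

open Filter Topology Set MeasureTheory Classical

noncomputable section

/-- The circle `S¹ = ℝ/ℤ`. -/
abbrev S1 := AddCircle (1 : ℝ)

/-- The group of homeomorphisms of the circle (composition as multiplication). -/
instance : Group (S1 ≃ₜ S1) where
  mul f g := g.trans f
  one := Homeomorph.refl _
  inv := Homeomorph.symm
  mul_assoc f g h := rfl
  one_mul f := Homeomorph.ext fun _ => rfl
  mul_one f := Homeomorph.ext fun _ => rfl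
  inv_mul_cancel f := Homeomorph.ext fun x => f.symm_apply_apply x

/-- `F` is a lift of the circle map `f` to the real line. -/
def IsLiftOf (F : CircleDeg1Lift) (f : S1 ≃ₜ S1) : Prop :=
  ∀ x : ℝ, f (x : S1) = ((F x : ℝ) : S1)

/-- `f` is an orientation-preserving homeomorphism of the circle: it admits a lift to
a monotone homeomorphism of `ℝ` commuting with integer translations. -/
def OrientationPreserving (f : S1 ≃ₜ S1) : Prop :=
  ∃ F : CircleDeg1Liftˣ, IsLiftOf (F : CircleDeg1Lift) f

/-- The rotation number `ρ(f) ∈ ℝ/ℤ` of an orientation-preserving circle homeomorphism: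
the translation number of a lift, taken modulo `ℤ` (independent of the lift). -/
def rotationNumber (f : S1 ≃ₜ S1) : AddCircle (1 : ℝ) :=
  if h : ∃ F : CircleDeg1Liftˣ, IsLiftOf (F : CircleDeg1Lift) f then
    (((h.choose : CircleDeg1Lift).translationNumber : ℝ) : AddCircle (1 : ℝ))
  else 0

/-- The orbit of `x` under a subgroup `Γ` of circle homeomorphisms. -/
def circleOrbit (Γ : Subgroup (S1 ≃ₜ S1)) (x : S1) : Set S1 :=
  {y : S1 | ∃ γ ∈ Γ, γ x = y}

/-- `Γ` has a finite orbit. -/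
def HasFiniteOrbit (Γ : Subgroup (S1 ≃ₜ S1)) : Prop :=
  ∃ x : S1, (circleOrbit Γ x).Finite

/-- `f` is an orientation-preserving real analytic diffeomorphism of the circle: it has a
lift which is a real analytic map `ℝ → ℝ` with everywhere positive derivative. -/
def IsAnalyticDiffeo (f : S1 ≃ₜ S1) : Prop :=
  ∃ F : CircleDeg1Liftˣ, IsLiftOf (F : CircleDeg1Lift) f ∧
    AnalyticOnNhd ℝ (⇑(F : CircleDeg1Lift)) Set.univ ∧
    ∀ x : ℝ, 0 < deriv (⇑(F : CircleDeg1Lift)) x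

/-- `Γ` is nondiscrete with respect to the `C¹`-topology: there is a sequence of elements of
`Γ ∖ {id}` converging to the identity in the `C¹`-topology (expressed via lifts). -/
def C1Nondiscrete (Γ : Subgroup (S1 ≃ₜ S1)) : Prop :=
  ∃ (f : ℕ → S1 ≃ₜ S1) (F : ℕ → CircleDeg1Liftˣ),
    (∀ n, f n ∈ Γ ∧ f n ≠ 1 ∧ IsLiftOf (F n : CircleDeg1Lift) (f n)) ∧
    ∀ ε : ℝ, 0 < ε → ∃ N : ℕ, ∀ n ≥ N, ∀ x : ℝ,
      |(F n : CircleDeg1Lift) x - x| < ε ∧ |deriv (⇑(F n : CircleDeg1Lift)) x - 1| < ε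

/-- `Γ` is locally nondiscrete with respect to the `C¹`-topology: some sequence of elements of
`Γ ∖ {id}` converges to the identity in the `C¹`-topology on some open interval of the circle
(an interval is described by a lift chart `]a, b[` with `b ≤ a + 1`). -/
def LocallyC1Nondiscrete (Γ : Subgroup (S1 ≃ₜ S1)) : Prop :=
  ∃ a b : ℝ, a < b ∧ b ≤ a + 1 ∧
    ∃ (f : ℕ → S1 ≃ₜ S1) (F : ℕ → CircleDeg1Liftˣ),
      (∀ n, f n ∈ Γ ∧ f n ≠ 1 ∧ IsLiftOf (F n : CircleDeg1Lift) (f n)) ∧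
      ∀ ε : ℝ, 0 < ε → ∃ N : ℕ, ∀ n ≥ N, ∀ x ∈ Ioo a b,
        |(F n : CircleDeg1Lift) x - x| < ε ∧ |deriv (⇑(F n : CircleDeg1Lift)) x - 1| < ε

/-- `Γ` is locally nondiscrete with respect to the `C⁰`-topology. -/
def LocallyC0Nondiscrete (Γ : Subgroup (S1 ≃ₜ S1)) : Prop :=
  ∃ a b : ℝ, a < b ∧ b ≤ a + 1 ∧
    ∃ (f : ℕ → S1 ≃ₜ S1) (F : ℕ → CircleDeg1Liftˣ),
      (∀ n, f n ∈ Γ ∧ f n ≠ 1 ∧ IsLiftOf (F n : CircleDeg1Lift) (f n)) ∧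
      ∀ ε : ℝ, 0 < ε → ∃ N : ℕ, ∀ n ≥ N, ∀ x ∈ Ioo a b,
        |(F n : CircleDeg1Lift) x - x| < ε

/-- There is a `Γ`-invariant Borel probability measure on the circle. -/
def HasInvariantProbMeasure (Γ : Subgroup (S1 ≃ₜ S1)) : Prop :=
  ∃ μ : Measure S1, IsProbabilityMeasure μ ∧ ∀ γ ∈ Γ, Measure.map (⇑γ) μ = μ

/-- `Γ` is minimal: every orbit is dense in the circle. -/
def IsMinimalSubgroup (Γ : Subgroup (S1 ≃ₜ S1)) : Prop :=
  ∀ x : S1, Dense (circleOrbit Γ x)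

/-- The closed arc `π([a, b])` of the circle. -/
def closedArc (a b : ℝ) : Set S1 :=
  (fun x : ℝ => (x : S1)) '' Icc a b

/-- The closed arc `π([a,b])` is `Γ`-contractible: some sequence `gₙ ∈ Γ` shrinks its
length to zero (lengths are measured via orientation-preserving lifts). -/
def ContractibleArc (Γ : Subgroup (S1 ≃ₜ S1)) (a b : ℝ) : Prop :=
  ∃ (g : ℕ → S1 ≃ₜ S1) (G : ℕ → CircleDeg1Liftˣ),
    (∀ n, g n ∈ Γ ∧ IsLiftOf (G n : CircleDeg1Lift) (g n)) ∧
    Tendsto (fun n => (G n : CircleDeg1Lift) b - (G n : CircleDeg1Lift) a) atTop (𝓝 0)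

/-- `Φ` is a local flow of the vector field `X` on the set `K` for times `0 ≤ t ≤ t₀`,
staying inside the domain `dom` of `X`. -/
def IsLocalFlowOn (X : ℝ → ℝ) (dom : Set ℝ) (Φ : ℝ → ℝ → ℝ) (K : Set ℝ) (t₀ : ℝ) : Prop :=
  (∀ x ∈ K, Φ 0 x = x) ∧
  ∀ x ∈ K, ∀ t ∈ Icc (0 : ℝ) t₀, Φ t x ∈ dom ∧
    HasDerivWithinAt (fun s => Φ s x) (X (Φ t x)) (Icc (0 : ℝ) t₀) t

/-- The local vector field `X` on the open interval `]a,b[` (in a lift chart of the circle)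
is in the `C⁰`-closure of `Γ` relative to this interval: every time-`t₀` map of its local flow
defined on a compact subinterval is a uniform limit of (lifts of) elements of `Γ`. -/
def InC0Closure (Γ : Subgroup (S1 ≃ₜ S1)) (a b : ℝ) (X : ℝ → ℝ) : Prop :=
  ∀ c d : ℝ, a < c → c ≤ d → d < b →
    ∀ t₀ : ℝ, 0 < t₀ → ∀ Φ : ℝ → ℝ → ℝ,
      IsLocalFlowOn X (Ioo a b) Φ (Icc c d) t₀ →
      ∃ (γ : ℕ → S1 ≃ₜ S1) (G : ℕ → CircleDeg1Liftˣ),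
        (∀ n, γ n ∈ Γ ∧ IsLiftOf (G n : CircleDeg1Lift) (γ n)) ∧
        TendstoUniformlyOn (fun n x => (G n : CircleDeg1Lift) x) (fun x => Φ t₀ x)
          atTop (Icc c d)


namespace RotAux

/-- Application of an invertible lift. -/
def ap (F : CircleDeg1Liftˣ) (x : ℝ) : ℝ := (F : CircleDeg1Lift) x

lemma ap_def (F : CircleDeg1Liftˣ) (x : ℝ) : ap F x = (F : CircleDeg1Lift) x := rfl

lemma ap_mul (F H : CircleDeg1Liftˣ) (x : ℝ) : ap (F * H) x = ap F (ap H x) := rfl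

lemma ap_one (x : ℝ) : ap 1 x = x := rfl

@[simp] lemma ap_inv_ap (F : CircleDeg1Liftˣ) (x : ℝ) : ap F⁻¹ (ap F x) = x :=
  CircleDeg1Lift.units_inv_apply_apply F x

@[simp] lemma ap_ap_inv (F : CircleDeg1Liftˣ) (x : ℝ) : ap F (ap F⁻¹ x) = x :=
  CircleDeg1Lift.units_apply_inv_apply F x

lemma ap_pow_succ (F : CircleDeg1Liftˣ) (n : ℕ) (x : ℝ) :
    ap (F ^ (n + 1)) x = ap F (ap (F ^ n) x) := by
  rw [pow_succ', ap_mul]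

lemma ap_pow_succ' (F : CircleDeg1Liftˣ) (n : ℕ) (x : ℝ) :
    ap (F ^ (n + 1)) x = ap (F ^ n) (ap F x) := by
  rw [pow_succ, ap_mul]

lemma ap_strictMono (F : CircleDeg1Liftˣ) : StrictMono (ap F) := by
  have : ap F = CircleDeg1Lift.toOrderIso F := rfl
  rw [this]
  exact (CircleDeg1Lift.toOrderIso F).strictMono

lemma ap_continuous (F : CircleDeg1Liftˣ) : Continuous (ap F) := by
  have : ap F = CircleDeg1Lift.toOrderIso F := rfl
  rw [this]
  exact (CircleDeg1Lift.toOrderIso F).continuous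

lemma ap_le {F : CircleDeg1Liftˣ} {x y : ℝ} : ap F x ≤ ap F y ↔ x ≤ y :=
  (ap_strictMono F).le_iff_le

lemma ap_lt {F : CircleDeg1Liftˣ} {x y : ℝ} : ap F x < ap F y ↔ x < y :=
  (ap_strictMono F).lt_iff_lt

lemma ap_add_one (F : CircleDeg1Liftˣ) (x : ℝ) : ap F (x + 1) = ap F x + 1 :=
  CircleDeg1Lift.map_add_one _ x

lemma ap_add_int (F : CircleDeg1Liftˣ) (x : ℝ) (m : ℤ) : ap F (x + m) = ap F x + m :=
  CircleDeg1Lift.map_add_int _ x m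

lemma ap_ext {F H : CircleDeg1Liftˣ} (h : ∀ x, ap F x = ap H x) : F = H :=
  Units.ext (CircleDeg1Lift.ext h)

/-- translation number -/
def tau (F : CircleDeg1Liftˣ) : ℝ := (F : CircleDeg1Lift).translationNumber

lemma tau_pow (F : CircleDeg1Liftˣ) (n : ℕ) : tau (F ^ n) = n * tau F := by
  unfold tau
  rw [Units.val_pow_eq_pow_val, CircleDeg1Lift.translationNumber_pow]

lemma tau_le_zero {F : CircleDeg1Liftˣ} {x : ℝ} (h : ap F x ≤ x) : tau F ≤ 0 := by
  have := CircleDeg1Lift.translationNumber_le_of_le_add_int (F : CircleDeg1Lift) (x := x) (m := 0)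
    (by simpa [ap_def] using h)
  simpa [tau] using this

lemma tau_le_one {F : CircleDeg1Liftˣ} {x : ℝ} (h : ap F x ≤ x + 1) : tau F ≤ 1 := by
  have := CircleDeg1Lift.translationNumber_le_of_le_add_int (F : CircleDeg1Lift) (x := x) (m := 1)
    (by simpa [ap_def] using h)
  simpa [tau] using this

lemma one_le_tau {F : CircleDeg1Liftˣ} {x : ℝ} (h : x + 1 ≤ ap F x) : 1 ≤ tau F := by
  have := CircleDeg1Lift.le_translationNumber_of_add_int_le (F : CircleDeg1Lift) (x := x) (m := 1)
    (by simpa [ap_def] using h)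
  simpa [tau] using this

/-- If the orbit of some point goes beyond `x + 1`, the translation number is positive. -/
lemma tau_pos {F : CircleDeg1Liftˣ} {x : ℝ} {n : ℕ} (h : x + 1 ≤ ap (F ^ n) x) : 0 < tau F := by
  have h1 := one_le_tau h
  rw [tau_pow] at h1
  by_contra hc
  push Not at hc
  have : (n : ℝ) * tau F ≤ 0 := mul_nonpos_of_nonneg_of_nonpos (Nat.cast_nonneg n) hc
  linarith

/-- orbit passes any point if there is no fixed point in between. -/
lemma exists_pow_ge {F : CircleDeg1Liftˣ} {a b : ℝ} (h : ∀ x ∈ Icc a b, x < ap F x) :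
    ∃ n : ℕ, b ≤ ap (F ^ n) a := by
  by_contra hc
  push Not at hc
  have hab : a < b := by simpa [ap_one] using hc 0
  have hge : ∀ n : ℕ, a ≤ ap (F ^ n) a := by
    intro n
    induction n with
    | zero => simp [ap_one]
    | succ n ih =>
      rw [ap_pow_succ]
      exact ih.trans (h _ ⟨ih, (hc n).le⟩).le
  obtain ⟨z, hz, hz2⟩ := isCompact_Icc.exists_isMinOn (nonempty_Icc.2 hab.le)
    (((ap_continuous F).sub continuous_id).continuousOn (s := Icc a b))
  have hs : 0 < ap F z - z := sub_pos.2 (h z hz)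
  have hmin : ∀ x ∈ Icc a b, ap F z - z ≤ ap F x - x := fun x hx => hz2 hx
  have hgrow : ∀ n : ℕ, a + n * (ap F z - z) ≤ ap (F ^ n) a := by
    intro n
    induction n with
    | zero => simp [ap_one]
    | succ n ih =>
      rw [ap_pow_succ]
      have := hmin _ ⟨hge n, (hc n).le⟩
      push_cast
      linarith
  obtain ⟨n, hn⟩ := exists_nat_gt ((b - a) / (ap F z - z))
  rw [div_lt_iff₀ hs] at hn
  have := hgrow n
  have := hc n
  linarith

/-- The flow property: elements of `G` with small positive displacement on `[a,b]`,
whose iterates are uniformly Lipschitz there. -/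
def Flow (G : Subgroup CircleDeg1Liftˣ) (a b L : ℝ) : Prop :=
  ∀ ε : ℝ, 0 < ε → ∃ F ∈ G, (∀ x ∈ Icc a b, x < ap F x ∧ ap F x < x + ε) ∧
    ∀ (j : ℕ) (x y : ℝ), a ≤ x → x ≤ y → ap (F ^ j) y ≤ b →
      ap (F ^ j) y - ap (F ^ j) x ≤ L * (y - x)

lemma Flow.mono {G : Subgroup CircleDeg1Liftˣ} {a b L b' : ℝ} (h : Flow G a b L) (hb : b' ≤ b) :
    Flow G a b' L := by
  intro ε hε
  obtain ⟨F, hF, h1, h2⟩ := h ε hε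
  exact ⟨F, hF, fun x hx => h1 x ⟨hx.1, hx.2.trans hb⟩,
    fun j x y hx hxy hy => h2 j x y hx hxy (hy.trans hb)⟩

/-- The arc `[x,y]` can be contracted by `G`. -/
def Contr (G : Subgroup CircleDeg1Liftˣ) (x y : ℝ) : Prop :=
  ∀ ε : ℝ, 0 < ε → ∃ F ∈ G, ap F y - ap F x < ε

lemma Contr.mono {G : Subgroup CircleDeg1Liftˣ} {x y x' y' : ℝ} (h : Contr G x y)
    (hx : x ≤ x') (hy : y' ≤ y) : Contr G x' y' := by
  intro ε hε
  obtain ⟨F, hF, h1⟩ := h ε hε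
  refine ⟨F, hF, lt_of_le_of_lt ?_ h1⟩
  have := ap_le (F := F).2 hx
  have := ap_le (F := F).2 hy
  linarith

lemma Contr.map {G : Subgroup CircleDeg1Liftˣ} {x y : ℝ} (h : Contr G x y)
    {H : CircleDeg1Liftˣ} (hH : H ∈ G) : Contr G (ap H x) (ap H y) := by
  intro ε hε
  obtain ⟨F, hF, h1⟩ := h ε hε
  refine ⟨F * H⁻¹, G.mul_mem hF (G.inv_mem hH), ?_⟩
  simpa [ap_mul] using h1

lemma Contr.lt {G : Subgroup CircleDeg1Liftˣ} {x y : ℝ} (h : Contr G x y) : y < x + 1 := by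
  by_contra hc
  push Not at hc
  obtain ⟨F, _, h1⟩ := h 1 one_pos
  have := ap_le (F := F).2 hc
  rw [ap_add_one] at this
  linarith

/-- The supremum of contractible arcs to the right of `x`. -/
def Th (G : Subgroup CircleDeg1Liftˣ) (x : ℝ) : ℝ := sSup {y | Contr G x y}

lemma Contr_bdd (G : Subgroup CircleDeg1Liftˣ) (x : ℝ) : BddAbove {y | Contr G x y} :=
  ⟨x + 1, fun _ hy => (Contr.lt hy).le⟩

lemma Contr.refl (G : Subgroup CircleDeg1Liftˣ) (x : ℝ) : Contr G x x :=
  fun ε hε => ⟨1, G.one_mem, by simpa using hε⟩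

lemma Contr.le_Th {G : Subgroup CircleDeg1Liftˣ} {x y : ℝ} (h : Contr G x y) : y ≤ Th G x :=
  le_csSup (Contr_bdd G x) h

lemma Contr_of_lt {G : Subgroup CircleDeg1Liftˣ} {x y : ℝ} (h : y < Th G x) : Contr G x y := by
  obtain ⟨z, hz, hyz⟩ := exists_lt_of_lt_csSup ⟨x, Contr.refl G x⟩ h
  exact Contr.mono hz le_rfl hyz.le

lemma Th_mono (G : Subgroup CircleDeg1Liftˣ) : Monotone (Th G) := by
  intro x y hxy
  apply csSup_le ⟨x, Contr.refl G x⟩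
  intro z hz
  exact (Contr.mono hz hxy le_rfl).le_Th

lemma Th_comm_le {G : Subgroup CircleDeg1Liftˣ} {H : CircleDeg1Liftˣ} (hH : H ∈ G) (x : ℝ) :
    ap H (Th G x) ≤ Th G (ap H x) := by
  apply le_of_forall_lt
  intro y hy
  have hy' : ap H⁻¹ y < Th G x := by
    rw [← ap_lt (F := H)]; simpa using hy
  obtain ⟨w, hw1, hw2⟩ := exists_between hy'
  have := (Contr_of_lt hw2).map hH
  have h2 := this.le_Th
  have h3 : y < ap H w := by
    have := ap_lt (F := H).2 hw1
    simpa using this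
  linarith

lemma Th_comm {G : Subgroup CircleDeg1Liftˣ} {H : CircleDeg1Liftˣ} (hH : H ∈ G) (x : ℝ) :
    Th G (ap H x) = ap H (Th G x) := by
  apply le_antisymm _ (Th_comm_le hH x)
  have := Th_comm_le (G.inv_mem hH) (ap H x)
  rw [ap_inv_ap] at this
  have := ap_le (F := H).2 this
  simpa using this

lemma Th_strictMono {G : Subgroup CircleDeg1Liftˣ}
    (hdense : ∀ x u v : ℝ, u < v → ∃ F ∈ G, ap F x ∈ Ioo u v)
    (htr : ∃ T ∈ G, ∀ x, ap T x = x + 1) : StrictMono (Th G) := by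
  intro u v huv
  refine lt_of_le_of_ne (Th_mono G huv.le) ?_
  intro heq
  have hconst : ∀ x ∈ Icc u v, Th G x = Th G u := fun x hx =>
    le_antisymm (heq ▸ Th_mono G hx.2) (Th_mono G hx.1)
  have hloc : IsLocallyConstant (Th G) := by
    rw [IsLocallyConstant.iff_eventually_eq]
    intro x
    obtain ⟨F, hF, hFx⟩ := hdense x u v huv
    have hnear : ∀ᶠ y in 𝓝 x, ap F y ∈ Ioo u v :=
      (ap_continuous F).continuousAt.eventually (isOpen_Ioo.mem_nhds hFx)
    filter_upwards [hnear] with y hy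
    have h1 := Th_comm hF x
    have h2 := Th_comm hF y
    rw [hconst _ (Ioo_subset_Icc_self hFx)] at h1
    rw [hconst _ (Ioo_subset_Icc_self hy), h1] at h2
    exact ((ap_strictMono F).injective h2).symm
  obtain ⟨T, hT, hT1⟩ := htr
  have h1 := Th_comm hT 0
  rw [hT1, hT1, hloc.apply_eq_of_isPreconnected isPreconnected_univ (mem_univ (0 + 1)) (mem_univ 0)] at h1
  linarith

lemma Th_iter_unbounded {G : Subgroup CircleDeg1Liftˣ}
    (hloc : ∀ x : ℝ, ∃ u v, u < x ∧ x < v ∧ Contr G u v) (x c : ℝ) :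
    ∃ n : ℕ, c ≤ (Th G)^[n] x := by
  by_contra hc
  push Not at hc
  have hbdd : BddAbove (Set.range fun n => (Th G)^[n] x) := ⟨c, by
    rintro _ ⟨n, rfl⟩
    exact (hc n).le⟩
  obtain ⟨u, v, hu, hv, huv⟩ := hloc (sSup (Set.range fun n => (Th G)^[n] x))
  obtain ⟨_, ⟨n, rfl⟩, hn⟩ := exists_lt_of_lt_csSup (Set.range_nonempty _) hu
  have h1 := (huv.mono hn.le le_rfl).le_Th
  simp only at h1
  rw [← Function.iterate_succ_apply' (Th G) n x] at h1
  have h2 : (Th G)^[n + 1] x ≤ sSup (Set.range fun n => (Th G)^[n] x) :=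
    le_csSup hbdd ⟨n + 1, rfl⟩
  linarith

/-- If `E` moves `[c, Θ c]` to the right then it has positive translation number. -/
lemma tau_pos_of_Th {G : Subgroup CircleDeg1Liftˣ}
    (hloc : ∀ x : ℝ, ∃ u v, u < x ∧ x < v ∧ Contr G u v) {E : CircleDeg1Liftˣ} (hE : E ∈ G)
    {c : ℝ} (h : ∀ x ∈ Icc c (Th G c), x < ap E x) : 0 < tau E := by
  obtain ⟨N, hN⟩ := exists_pow_ge h
  have key : ∀ n : ℕ, (Th G)^[n] c ≤ ap ((E ^ N) ^ n) c := by
    intro n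
    induction n with
    | zero => simp [ap_one]
    | succ n ih =>
      rw [Function.iterate_succ_apply']
      have h1 := Th_mono G ih
      rw [Th_comm (G.pow_mem (G.pow_mem hE _) _)] at h1
      have h2 := ap_le (F := (E ^ N) ^ n).2 hN
      rw [pow_succ, ap_mul]
      exact h1.trans h2
  obtain ⟨n, hn⟩ := Th_iter_unbounded hloc c (c + 1)
  have h3 := hn.trans (key n)
  rw [← pow_mul] at h3
  exact tau_pos h3

/-- Existence of a strongly contracting element. -/
lemma exists_contracting {G : Subgroup CircleDeg1Liftˣ}
    (hdense : ∀ x u v : ℝ, u < v → ∃ F ∈ G, ap F x ∈ Ioo u v)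
    (htr : ∃ T ∈ G, ∀ x, ap T x = x + 1) {x y u v : ℝ} (hxy : Contr G x y)
    (huv : u < v) (hle : x ≤ y) : ∃ B ∈ G, u < ap B x ∧ ap B y < v := by
  have step : ∀ n : ℕ, ∃ F ∈ G, ap F y - ap F x < 1 / ((n : ℝ) + 1) ∧ ap F x ∈ Icc (0 : ℝ) 1 := by
    intro n
    obtain ⟨F, hF, h1⟩ := hxy (1 / ((n : ℝ) + 1)) (by positivity)
    obtain ⟨T, hT, hT1⟩ := htr
    have hTz : ∀ (m : ℤ) (z : ℝ), ap (T ^ m) z = z + m := by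
      intro m
      induction m using Int.induction_on with
      | zero => intro z; simp [ap_one]
      | succ i ih =>
        intro z
        rw [zpow_add, zpow_one, ap_mul, hT1, ih]; push_cast; ring
      | pred i ih =>
        intro z
        have hTi : ap T⁻¹ z = z - 1 := by
          apply (ap_strictMono T).injective
          rw [ap_ap_inv, hT1]; ring
        rw [sub_eq_add_neg, zpow_add, zpow_neg_one, ap_mul, hTi, ih]; push_cast; ring
    refine ⟨T ^ (-⌊ap F x⌋) * F, G.mul_mem (G.zpow_mem hT _) hF, ?_, ?_⟩
    · simp only [ap_mul, hTz]; linarith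
    · simp only [ap_mul, hTz]
      push_cast
      constructor
      · linarith [Int.floor_le (ap F x)]
      · linarith [Int.lt_floor_add_one (ap F x)]
  choose F hF h1 h2 using step
  obtain ⟨ξ, _, φ, hφ, hlim⟩ := isCompact_Icc.tendsto_subseq h2
  obtain ⟨H, hH, hHξ⟩ := hdense ξ u v huv
  have hlim2 : Tendsto (fun n => ap (F (φ n)) y) atTop (𝓝 ξ) := by
    have hd : Tendsto (fun n => ap (F (φ n)) y - ap (F (φ n)) x) atTop (𝓝 0) := by
      apply squeeze_zero (g := fun n => 1 / (((φ n : ℕ) : ℝ) + 1))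
      · intro n
        exact sub_nonneg.2 (ap_le.2 hle)
      · intro n
        exact (h1 _).le
      · exact tendsto_one_div_add_atTop_nhds_zero_nat.comp hφ.tendsto_atTop
    have := hlim.add hd
    simpa using this
  have e1 := ((ap_continuous H).tendsto ξ).comp hlim
  have e2 := ((ap_continuous H).tendsto ξ).comp hlim2
  have e3 := (e1.eventually (isOpen_Ioo.mem_nhds hHξ)).and (e2.eventually (isOpen_Ioo.mem_nhds hHξ))
  obtain ⟨n, hn1, hn2⟩ := e3.exists
  exact ⟨H * F (φ n), G.mul_mem hH (hF _), hn1.1, hn2.2⟩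

/-- The final contradiction in the minimal case. -/
theorem flow_contradiction {G : Subgroup CircleDeg1Liftˣ}
    (hdense : ∀ x u v : ℝ, u < v → ∃ F ∈ G, ap F x ∈ Ioo u v)
    (htr : ∃ T ∈ G, ∀ x, ap T x = x + 1)
    (hloc : ∀ x : ℝ, ∃ u v, u < x ∧ x < v ∧ Contr G u v)
    (hlip : ∀ F ∈ G, ∃ K : ℝ, 0 ≤ K ∧ ∀ x y, x ≤ y → ap F y - ap F x ≤ K * (y - x))
    {δ : ℝ} (hδ : 0 < δ) (hgap : ∀ F ∈ G, 0 < tau F → δ ≤ tau F)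
    {a b₁ L : ℝ} (hab : a < b₁) (hL : 0 < L) (hflow : Flow G a b₁ L) : False := by
  have hTha : a < Th G a := by
    obtain ⟨u, v, hu, hv, huv⟩ := hloc a
    exact lt_of_lt_of_le hv (huv.mono hu.le le_rfl).le_Th
  have hThs := Th_strictMono hdense htr
  -- shrink the interval
  obtain ⟨b', hb'1, hb'2⟩ : ∃ b', a < b' ∧ b' < min b₁ (Th G a) := exists_between (lt_min hab hTha)
  have hflow' : Flow G a b' L := hflow.mono (hb'2.le.trans (min_le_left _ _))
  have hb'Th : b' < Th G a := lt_of_lt_of_le hb'2 (min_le_right _ _)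
  obtain ⟨b, hab', hbb'⟩ := exists_between hb'1
  obtain ⟨o, hao, hob⟩ := exists_between hab'
  have hcontr : Contr G b (Th G o) := Contr_of_lt (hThs hob)
  obtain ⟨B, hB, hB1, hB2⟩ := exists_contracting hdense htr hcontr (hThs hao)
    (hbb'.le.trans (hb'Th.le.trans (Th_mono G hao.le)))
  have hBo : ap B o < o := by
    rw [← Th_comm hB] at hB2 
    exact (hThs.lt_iff_lt).1 hB2
  have hBa : a < ap B a := by
    apply (hThs.lt_iff_lt).1
    rw [Th_comm hB]
    exact lt_of_lt_of_le hB1 (ap_le.2 (hbb'.le.trans hb'Th.le))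
  obtain ⟨K, hK0, hK⟩ := hlip B hB
  -- constants
  obtain ⟨m, hm⟩ := exists_nat_gt (1 / δ)
  have hm1 : 1 < m * δ := by rwa [div_lt_iff₀ hδ] at hm
  set Λ : ℝ := max 1 (L * K) with hΛ
  have hΛ1 : 1 ≤ Λ := le_max_left _ _
  have hΛ2 : L * K ≤ Λ := le_max_right _ _
  set S : ℕ → ℝ := fun i => ∑ k ∈ Finset.range i, Λ ^ k with hS
  have hSmono : Monotone S := by
    apply monotone_nat_of_le_succ
    intro n
    simp only [hS, Finset.sum_range_succ]
    have : 0 ≤ Λ ^ n := by positivity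
    linarith
  have hSsucc : ∀ i, S (i + 1) = 1 + Λ * S i := by
    intro i
    simp only [hS, Finset.sum_range_succ', Finset.mul_sum, pow_succ']
    simp [add_comm]
  have hS0 : S 0 = 0 := by simp [hS]
  have hSnn : ∀ i, 0 ≤ S i := fun i => hS0 ▸ hSmono (Nat.zero_le i)
  set κ := min (b' - b) 1 with hκ
  have hκ0 : 0 < κ := lt_min (by linarith) one_pos
  set ε := κ / (S m + 1) with hε
  have hε0 : 0 < ε := div_pos hκ0 (by linarith [hSnn m])
  have hεS : ∀ i ≤ m, ε * S i ≤ κ := by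
    intro i hi
    have h1 : S i ≤ S m + 1 := by linarith [hSmono hi]
    have h2 := mul_le_mul_of_nonneg_left h1 hε0.le
    have h3 : ε * (S m + 1) = κ := by
      rw [hε]; field_simp [show S m + 1 ≠ 0 by linarith [hSnn m]]
    linarith
  obtain ⟨F, hF, hF1, hF2⟩ := hflow' ε hε0
  have hFge : ∀ (x : ℝ), x ∈ Icc a b' → ∀ j : ℕ, x ≤ ap (F ^ j) x := by
    intro x hx j
    induction j with
    | zero => simp [ap_one]
    | succ n ih =>
      rw [ap_pow_succ]
      have := (hF1 x hx).1
      have h2 := ap_le (F := F).2 ih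
      linarith
  have hEG : ∀ j : ℕ, F ^ j * B ∈ G := fun j => G.mul_mem (G.pow_mem hF j) hB
  obtain ⟨M, hM⟩ : ∃ n : ℕ, b ≤ ap (F ^ n) a :=
    exists_pow_ge fun x hx => (hF1 x ⟨hx.1, hx.2.trans hbb'.le⟩).1
  have hEM : 0 < tau (F ^ M * B) := by
    apply tau_pos_of_Th hloc (hEG M) (c := a)
    intro x hx
    rw [ap_mul]
    rcases le_total x b with hxb | hxb
    · have h1 : ap B a ≤ ap B x := ap_le.2 hx.1
      have h2 : ap (F ^ M) a < ap (F ^ M) (ap B x) := ap_lt.2 (lt_of_lt_of_le hBa h1)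
      linarith
    · have h1 : Th G a < ap B x := lt_of_lt_of_le hB1 (ap_le.2 hxb)
      have h2 : ap (F ^ M) (Th G a) < ap (F ^ M) (ap B x) := ap_lt.2 h1
      rw [← Th_comm (G.pow_mem hF M)] at h2
      have h3 : Th G a ≤ Th G (ap (F ^ M) a) := Th_mono G (by linarith)
      linarith [hx.2]
  have hE0 : ¬ 0 < tau (F ^ 0 * B) := by
    rw [not_lt]
    apply tau_le_zero (x := o)
    simpa [ap_mul, ap_one] using hBo.le
  -- the transition index
  obtain ⟨j, hj1, hj2⟩ : ∃ j : ℕ, ¬ 0 < tau (F ^ j * B) ∧ 0 < tau (F ^ (j + 1) * B) := by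
    by_contra hc
    push Not at hc
    have : ∀ j : ℕ, tau (F ^ j * B) ≤ 0 := by
      intro j
      induction j with
      | zero => exact not_lt.1 hE0
      | succ n ih => exact hc n ih
    exact absurd hEM (not_lt.2 (this M))
  have haj : a ≤ ap (F ^ j) a := hFge a ⟨le_rfl, hb'1.le⟩ j
  set c := min (ap (F ^ j) a) b with hc
  have hac : a ≤ c := le_min haj hab'.le
  have hcb : c ≤ b := min_le_right _ _
  obtain ⟨z, hz, hzE⟩ : ∃ z ∈ Icc c (Th G c), ap (F ^ j * B) z ≤ z := by
    by_contra hcon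
    push Not at hcon
    exact hj1 (tau_pos_of_Th hloc (hEG j) hcon)
  have hzb : z < b := by
    by_contra hcon
    push Not at hcon
    have h1 : Th G a < ap B z := lt_of_lt_of_le hB1 (ap_le.2 hcon)
    have h2 : ap (F ^ j) (Th G a) < ap (F ^ j) (ap B z) := ap_lt.2 h1
    rw [← Th_comm (G.pow_mem hF j), ← ap_mul] at h2
    have h3 : Th G c ≤ Th G (ap (F ^ j) a) := Th_mono G (min_le_left _ _)
    linarith [hz.2]
  have haz : a ≤ z := hac.trans hz.1
  have hBz : a ≤ ap B z := hBa.le.trans (ap_le.2 haz)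
  have hEz : ap (F ^ (j + 1) * B) z ≤ z + ε := by
    rw [ap_mul, ap_pow_succ, ← ap_mul]
    exact (ap_le.2 hzE).trans (hF1 z ⟨haz, (hzb.trans hbb').le⟩).2.le
  have hstep : ∀ s : ℝ, 0 ≤ s → z + ε + Λ * s ≤ b' →
      ap (F ^ (j + 1) * B) (z + s) ≤ z + ε + Λ * s := by
    intro s hs hsb
    set E := F ^ (j + 1) with hE
    have hBs : 0 ≤ ap B (z + s) - ap B z := sub_nonneg.2 (ap_le.2 (by linarith))
    have hBs2 : ap B (z + s) - ap B z ≤ K * s := by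
      have := hK z (z + s) (by linarith)
      simpa using this
    set y := ap E (ap B z) + L * (ap B (z + s) - ap B z) with hy
    rw [ap_mul] at hEz
    have hLK : L * (ap B (z + s) - ap B z) ≤ Λ * s := by
      calc L * (ap B (z + s) - ap B z) ≤ L * (K * s) := by gcongr
        _ = (L * K) * s := by ring
        _ ≤ Λ * s := by gcongr
    have hyb : y ≤ z + ε + Λ * s := by rw [hy]; linarith
    have hxy : ap B z ≤ ap E⁻¹ y := by
      rw [← ap_le (F := E), ap_ap_inv, hy]
      have := mul_nonneg hL.le hBs
      linarith
    have h1 := hF2 (j + 1) (ap B z) (ap E⁻¹ y) hBz hxy (by rw [← hE, ap_ap_inv]; linarith)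
    rw [← hE, ap_ap_inv] at h1
    have h2 : L * (ap B (z + s) - ap B z) ≤ L * (ap E⁻¹ y - ap B z) := by
      rw [hy] at h1 ⊢; linarith
    have h3 := le_of_mul_le_mul_left h2 hL
    have h4 : ap B (z + s) ≤ ap E⁻¹ y := by linarith
    have h5 := ap_le (F := E).2 h4
    rw [ap_ap_inv] at h5
    rw [ap_mul]
    linarith
  have hiter : ∀ i ≤ m, ap ((F ^ (j + 1) * B) ^ i) z ≤ z + ε * S i := by
    intro i
    induction i with
    | zero => intro _; simp [ap_one, hS0]
    | succ i ih =>
      intro hi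
      have h1 := ih (by omega)
      rw [ap_pow_succ]
      have h2 := ap_le (F := F ^ (j + 1) * B).2 h1
      have h3 : ε * S (i + 1) = ε + Λ * (ε * S i) := by rw [hSsucc]; ring
      have h4 := hstep (ε * S i) (mul_nonneg hε0.le (hSnn i)) (by
        have h5 := hεS (i + 1) hi
        have h6 : κ ≤ b' - b := min_le_left _ _
        linarith)
      linarith
  have h1 := hiter m le_rfl
  have h2 := hεS m le_rfl
  have h3 : κ ≤ 1 := min_le_right _ _
  have h4 := tau_le_one (x := z) (h1.trans (by linarith))
  rw [tau_pow] at h4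
  have h5 := hgap _ (hEG (j + 1)) hj2
  have h6 : (m : ℝ) * δ ≤ m * tau (F ^ (j + 1) * B) := by gcongr
  linarith

end RotAux

namespace RotAux

/-- `f` is `η`-close to a translation in the `C¹` sense. -/
def NearTr (f : CircleDeg1Liftˣ) (η : ℝ) : Prop :=
  ∀ x y : ℝ, x ≤ y → |(ap f y - y) - (ap f x - x)| ≤ η * (y - x)

lemma NearTr.abs {f : CircleDeg1Liftˣ} {η : ℝ} (h : NearTr f η) (x y : ℝ) :
    |(ap f y - y) - (ap f x - x)| ≤ η * |y - x| := by
  rcases le_total x y with hxy | hxy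
  · rw [abs_of_nonneg (sub_nonneg.2 hxy)]; exact h x y hxy
  · rw [abs_sub_comm, abs_sub_comm y x, abs_of_nonneg (sub_nonneg.2 hxy)]; exact h y x hxy

/-- distortion control for a sequence of maps. -/
def Dist (H : ℕ → CircleDeg1Liftˣ) (ℓ : ℕ → ℝ) (D x₃ x₀ : ℝ) : Prop :=
  ∀ (l : ℕ) (u v : ℝ), x₃ ≤ u → u ≤ v → v ≤ x₀ →
    ℓ l * (v - u) ≤ D * (ap (H l) v - ap (H l) u) ∧
    ap (H l) v - ap (H l) u ≤ D * (ℓ l * (v - u))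

lemma Dist.weaken {H : ℕ → CircleDeg1Liftˣ} {ℓ : ℕ → ℝ} {D D' x₃ x₀ : ℝ} (h : Dist H ℓ D x₃ x₀)
    (hD : D ≤ D') (hℓ : ∀ l, 0 < ℓ l) : Dist H ℓ D' x₃ x₀ := by
  intro l u v hu huv hv
  obtain ⟨h1, h2⟩ := h l u v hu huv hv
  have h3 : 0 ≤ ap (H l) v - ap (H l) u := sub_nonneg.2 (ap_le.2 huv)
  have h4 : 0 ≤ ℓ l * (v - u) := mul_nonneg (hℓ l).le (sub_nonneg.2 huv)
  exact ⟨h1.trans (by gcongr), h2.trans (by gcongr)⟩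

/-- First crossing: zooming with `H l = P * g ^ l` finds an almost translation of size about `t`. -/
lemma crossing {G : Subgroup CircleDeg1Liftˣ} {f g P : CircleDeg1Liftˣ} (hf : f ∈ G)
    {η D t C₀ x₀ : ℝ} {ℓ : ℕ → ℝ} (hℓ : ∀ l, 0 < ℓ l) (hη0 : 0 ≤ η) (hη : η ≤ 1 / 2)
    (hfη : NearTr f η) (hD1 : 1 ≤ D) (ht : 0 < t) (hgx : ap g x₀ < x₀)
    (hD : Dist (fun l => P * g ^ l) ℓ D (ap (g ^ 3) x₀) x₀)
    (hC₀ : D * D * (x₀ - ap (g ^ 2) x₀) ≤ C₀ * (ap g x₀ - ap (g ^ 3) x₀))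
    (hηt : η * D * (x₀ - ap (g ^ 3) x₀) ≤ t / 2)
    (h0 : |ap f (ap P x₀) - ap P x₀| ≤ t * ℓ 0)
    (hex : ∃ l, t * ℓ l < |ap f (ap (P * g ^ l) x₀) - ap (P * g ^ l) x₀|) :
    ∃ φ ∈ G, ∃ l, (∀ x ∈ Icc (ap (g ^ 3) x₀) x₀,
        t / 4 * ℓ l ≤ ap φ (ap (P * g ^ l) x) - ap (P * g ^ l) x ∧
        ap φ (ap (P * g ^ l) x) - ap (P * g ^ l) x ≤ (3 * C₀ + 1) * t * ℓ l) ∧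
      ∀ x y : ℝ, x ≤ y → ap φ y - ap φ x ≤ (1 + 2 * η) * (y - x) := by
  -- ordering of the points
  have h21 : ap (g ^ 2) x₀ < ap g x₀ := by
    rw [pow_two, ap_mul]; exact ap_lt.2 hgx
  have h32 : ap (g ^ 3) x₀ < ap (g ^ 2) x₀ := by
    rw [show (3:ℕ) = 2 + 1 from rfl, ap_pow_succ']; exact ap_lt.2 hgx
  set x₁ := ap g x₀ with hx₁
  set x₂ := ap (g ^ 2) x₀ with hx₂
  set x₃ := ap (g ^ 3) x₀ with hx₃
  set d : ℝ → ℝ := fun y => ap f y - y with hd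
  have hdd : ∀ x y, |d y - d x| ≤ η * |y - x| := fun x y => hfη.abs x y
  set l := Nat.find hex with hl
  have hl1 : t * ℓ l < |d (ap (P * g ^ l) x₀)| := Nat.find_spec hex
  have hlpos : l ≠ 0 := by
    intro h
    rw [h] at hl1
    simp only [pow_zero, mul_one] at hl1
    exact absurd hl1 (not_lt.2 h0)
  obtain ⟨k, hk⟩ := Nat.exists_eq_succ_of_ne_zero hlpos
  have hk1 : |d (ap (P * g ^ k) x₀)| ≤ t * ℓ k :=
    not_lt.1 (Nat.find_min hex (show k < Nat.find hex by omega))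
  have hshift : ∀ x, ap (P * g ^ (k + 1)) x = ap (P * g ^ k) (ap g x) := by
    intro x; rw [ap_mul, ap_pow_succ', ← ap_mul]
  -- comparison of consecutive scales
  have hℓk : ℓ k ≤ C₀ * ℓ (k + 1) := by
    obtain ⟨h1, -⟩ := hD k x₃ x₁ le_rfl (h32.trans h21).le hgx.le
    obtain ⟨-, h2⟩ := hD (k + 1) x₂ x₀ h32.le (h21.trans hgx).le le_rfl
    simp only [hshift] at h1 h2
    have e1 : ap g x₂ = x₃ := (ap_pow_succ g 2 x₀).symm
    rw [e1] at h2
    have h3 : ℓ k * (x₁ - x₃) ≤ ℓ (k + 1) * (D * D * (x₀ - x₂)) := by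
      calc ℓ k * (x₁ - x₃) ≤ D * (ap (P * g ^ k) x₁ - ap (P * g ^ k) x₃) := h1
        _ ≤ D * (D * (ℓ (k + 1) * (x₀ - x₂))) := by gcongr
        _ = _ := by ring
    have h4 : ℓ (k + 1) * (D * D * (x₀ - x₂)) ≤ ℓ (k + 1) * (C₀ * (x₁ - x₃)) :=
      mul_le_mul_of_nonneg_left hC₀ (hℓ _).le
    have h5 : ℓ k * (x₁ - x₃) ≤ (C₀ * ℓ (k + 1)) * (x₁ - x₃) := by linarith
    exact le_of_mul_le_mul_right h5 (by linarith)
  have hDvar : ∀ (i : ℕ) (u v : ℝ), x₃ ≤ u → u ≤ v → v ≤ x₀ →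
      |d (ap (P * g ^ i) v) - d (ap (P * g ^ i) u)| ≤ t / 2 * ℓ i := by
    intro i u v hu huv hv
    obtain ⟨-, h2⟩ := hD i u v hu huv hv
    simp only at h2
    have h3 : 0 ≤ ap (P * g ^ i) v - ap (P * g ^ i) u := sub_nonneg.2 (ap_le.2 huv)
    have h4 := hdd (ap (P * g ^ i) u) (ap (P * g ^ i) v)
    rw [abs_of_nonneg h3] at h4
    have hℓi := hℓ i
    calc |d (ap (P * g ^ i) v) - d (ap (P * g ^ i) u)|
        ≤ η * (D * (ℓ i * (v - u))) := h4.trans (by gcongr)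
      _ ≤ η * (D * (ℓ i * (x₀ - x₃))) := by gcongr
      _ = (η * D * (x₀ - x₃)) * ℓ i := by ring
      _ ≤ t / 2 * ℓ i := by gcongr
  have hup : |d (ap (P * g ^ l) x₀)| ≤ 3 / 2 * C₀ * t * ℓ l := by
    have h1 := hDvar k x₁ x₀ (h32.trans h21).le hgx.le le_rfl
    have h2 : ap (P * g ^ l) x₀ = ap (P * g ^ k) x₁ := by rw [hk, Nat.succ_eq_add_one, hshift]
    rw [h2]
    have h3 : |d (ap (P * g ^ k) x₁)| ≤ 3 / 2 * t * ℓ k := by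
      have := abs_sub_abs_le_abs_sub (d (ap (P * g ^ k) x₁)) (d (ap (P * g ^ k) x₀))
      rw [abs_sub_comm (d (ap (P * g ^ k) x₁)) (d (ap (P * g ^ k) x₀))] at this
      linarith
    have h4 : 3 / 2 * t * ℓ k ≤ 3 / 2 * t * (C₀ * ℓ l) := by
      rw [hk]; gcongr
    linarith
  have hC₀0 : 0 ≤ C₀ * ℓ l := by
    rw [hk]; exact (hℓ k).le.trans hℓk
  have hall : ∀ x ∈ Icc x₃ x₀, |d (ap (P * g ^ l) x) - d (ap (P * g ^ l) x₀)| ≤ t / 2 * ℓ l := by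
    intro x hx
    rw [abs_sub_comm]
    exact hDvar l x x₀ hx.1 hx.2 le_rfl
  have htl : 0 < t * ℓ l := mul_pos ht (hℓ l)
  rcases le_or_gt 0 (d (ap (P * g ^ l) x₀)) with hpos | hneg
  · refine ⟨f, hf, l, ?_, ?_⟩
    · intro x hx
      have h1 := abs_le.1 (hall x hx)
      rw [abs_of_nonneg hpos] at hl1 hup
      have h2 : ap f (ap (P * g ^ l) x) - ap (P * g ^ l) x = d (ap (P * g ^ l) x) := rfl
      rw [h2]
      have : 0 ≤ t * (C₀ * ℓ l) := by positivity
      constructor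
      · linarith
      · nlinarith
    · intro x y hxy
      have h1 := (abs_le.1 (hfη x y hxy)).2
      have : 0 ≤ η * (y - x) := mul_nonneg hη0 (sub_nonneg.2 hxy)
      linarith
  · refine ⟨f⁻¹, G.inv_mem hf, l, ?_, ?_⟩
    · intro x hx
      have h1 := abs_le.1 (hall x hx)
      rw [abs_of_neg hneg] at hl1 hup
      set y := ap (P * g ^ l) x with hy
      have hdy1 : d y ≤ -(t / 2 * ℓ l) := by linarith
      have hdy2 : -((3 / 2 * C₀ + 1 / 2) * t * ℓ l) ≤ d y := by linarith
      set w := ap f⁻¹ y with hw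
      have hfw : ap f w = y := by rw [hw, ap_ap_inv]
      have hdw : d w = y - w := by simp only [hd, hfw]
      have hyw : y < w := by
        rw [← ap_lt (F := f), hfw]
        have : ap f y - y ≤ -(t / 2 * ℓ l) := hdy1
        linarith
      have h3 := abs_le.1 (hdd y w)
      rw [abs_of_pos (sub_pos.2 hyw), hdw] at h3
      have h5 : η * (w - y) ≤ 1 / 2 * (w - y) := by
        have : 0 ≤ w - y := by linarith
        gcongr
      have : 0 ≤ t * (C₀ * ℓ l) := by positivity
      constructor
      · linarith [h3.1, h3.2]
      · have h6 : w - y ≤ 2 * ((3 / 2 * C₀ + 1 / 2) * t * ℓ l) := by linarith [h3.1, h3.2]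
        linarith
    · intro x y hxy
      have h0 : ap f⁻¹ x ≤ ap f⁻¹ y := ap_le.2 hxy
      have h1 := (abs_le.1 (hfη _ _ h0)).1
      rw [ap_ap_inv, ap_ap_inv] at h1
      set w := ap f⁻¹ y - ap f⁻¹ x with hw
      have hw0 : 0 ≤ w := sub_nonneg.2 h0
      have h2 : (1 - η) * w ≤ y - x := by
        have : -(η * w) ≤ y - x - w := by rw [hw]; rw [hw] at h1; linarith
        linarith
      have h3 : w ≤ (1 + 2 * η) * ((1 - η) * w) := by
        have : 0 ≤ η * (1 - 2 * η) * w := by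
          apply mul_nonneg (mul_nonneg hη0 (by linarith)) hw0
        nlinarith
      calc w ≤ (1 + 2 * η) * ((1 - η) * w) := h3
        _ ≤ (1 + 2 * η) * (y - x) := by gcongr

/-- From a crossing to a flow element. -/
lemma crossing_flow {G : Subgroup CircleDeg1Liftˣ} {f g P : CircleDeg1Liftˣ} (hf : f ∈ G)
    (hg : g ∈ G) (hP : P ∈ G)
    {η D t C₀ x₀ ε : ℝ} {ℓ : ℕ → ℝ} (hℓ : ∀ l, 0 < ℓ l) (hη0 : 0 ≤ η) (hη : η ≤ 1 / 2)
    (hfη : NearTr f η) (hD1 : 1 ≤ D) (ht : 0 < t) (hgx : ap g x₀ < x₀)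
    (hD : Dist (fun l => P * g ^ l) ℓ D (ap (g ^ 3) x₀) x₀)
    (hC₀ : D * D * (x₀ - ap (g ^ 2) x₀) ≤ C₀ * (ap g x₀ - ap (g ^ 3) x₀))
    (hηt : 16 * η * D * (x₀ - ap (g ^ 3) x₀) ≤ t)
    (h0 : |ap f (ap P x₀) - ap P x₀| ≤ t * ℓ 0)
    (hex : ∃ l, t * ℓ l < |ap f (ap (P * g ^ l) x₀) - ap (P * g ^ l) x₀|)
    (hε : ε ≤ x₀ - ap g x₀) (hεt : (3 * C₀ + 1) * t * D < ε) (hε0 : 0 < ε) :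
    ∃ F ∈ G, (∀ x ∈ Icc (ap (g ^ 2) x₀) (ap g x₀), x < ap F x ∧ ap F x < x + ε) ∧
      ∀ (j : ℕ) (x y : ℝ), ap (g ^ 2) x₀ ≤ x → x ≤ y → ap (F ^ j) y ≤ ap g x₀ →
        ap (F ^ j) y - ap (F ^ j) x ≤ (2 * D * D) * (y - x) := by
  have h21 : ap (g ^ 2) x₀ < ap g x₀ := by
    rw [pow_two, ap_mul]; exact ap_lt.2 hgx
  have h32 : ap (g ^ 3) x₀ < ap (g ^ 2) x₀ := by
    rw [show (3:ℕ) = 2 + 1 from rfl, ap_pow_succ']; exact ap_lt.2 hgx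
  have hηD : 0 ≤ η * D := mul_nonneg hη0 (by linarith)
  obtain ⟨φ, hφ, l, hφ1, hφ2⟩ := crossing hf hℓ hη0 hη hfη hD1 ht hgx hD hC₀
    (by have : 0 ≤ η * D * (x₀ - ap (g ^ 3) x₀) := mul_nonneg hηD (by linarith)
        linarith) h0 hex
  set x₁ := ap g x₀ with hx₁
  set x₂ := ap (g ^ 2) x₀ with hx₂
  set x₃ := ap (g ^ 3) x₀ with hx₃
  set H := P * g ^ l with hH
  have hHG : H ∈ G := G.mul_mem hP (G.pow_mem hg l)
  set ll := ℓ l with hll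
  have hll0 : 0 < ll := hℓ l
  have hDl : ∀ u v : ℝ, x₃ ≤ u → u ≤ v → v ≤ x₀ → ll * (v - u) ≤ D * (ap H v - ap H u) ∧
      ap H v - ap H u ≤ D * (ll * (v - u)) := fun u v => hD l u v
  set F := H⁻¹ * φ * H with hF
  have hHF : ∀ x, ap H (ap F x) = ap φ (ap H x) := by
    intro x; exact ap_ap_inv H (ap φ (ap H x))
  have hD0 : 0 < D := by linarith
  have hdisp : ∀ x ∈ Icc x₂ x₁, x + t / (4 * D) ≤ ap F x ∧ ap F x < x + ε := by
    intro x hx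
    have hx' : x ∈ Icc x₃ x₀ := ⟨h32.le.trans hx.1, hx.2.trans hgx.le⟩
    obtain ⟨h1, h2⟩ := hφ1 x hx'
    have hlt : ap F x < x + ε := by
      rw [← ap_lt (F := H), hHF]
      obtain ⟨h3, -⟩ := hDl x (x + ε) hx'.1 (by linarith) (by linarith [hx.2])
      have h4 : (3 * C₀ + 1) * t * D * ll < ε * ll := by gcongr
      have h5 : D * ((3 * C₀ + 1) * t * ll) < D * (ap H (x + ε) - ap H x) := by
        have : ll * (x + ε - x) = ε * ll := by ring
        linarith
      have h6 := lt_of_mul_lt_mul_left h5 hD0.le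
      linarith
    have hge : x ≤ ap F x := by
      rw [← ap_le (F := H), hHF]
      have : 0 ≤ t / 4 * ll := by positivity
      linarith
    refine ⟨?_, hlt⟩
    obtain ⟨-, h3⟩ := hDl x (ap F x) hx'.1 hge (by linarith [hx.2])
    rw [hHF] at h3
    have h4 : ll * (t / 4) ≤ ll * (D * (ap F x - x)) := by linarith
    have h5 := le_of_mul_le_mul_left h4 hll0
    have h6 : t / (4 * D) ≤ ap F x - x := by
      rw [div_le_iff₀ (by positivity)]
      linarith
    linarith
  have hs0 : 0 < t / (4 * D) := by positivity
  refine ⟨F, G.mul_mem (G.mul_mem (G.inv_mem hHG) hφ) hHG, ?_, ?_⟩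
  · intro x hx
    obtain ⟨h1, h2⟩ := hdisp x hx
    exact ⟨by linarith, h2⟩
  · have hcount : ∀ (j : ℕ) (x : ℝ), x₂ ≤ x → ap (F ^ j) x ≤ x₁ →
        x + j * (t / (4 * D)) ≤ ap (F ^ j) x := by
      intro j x hx
      induction j with
      | zero => intro _; simp [ap_one]
      | succ j ih =>
        intro hj
        rw [ap_pow_succ] at hj ⊢
        have h1 : ap (F ^ j) x ≤ x₁ := by
          by_contra hcon
          push Not at hcon
          have h2 := ap_lt (F := F).2 hcon
          have h3 := (hdisp x₁ ⟨h21.le, le_rfl⟩).1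
          linarith
        have h2 := ih h1
        have h3 : 0 ≤ (j : ℝ) * (t / (4 * D)) := by positivity
        have h4 := (hdisp _ ⟨by linarith, h1⟩).1
        push_cast
        linarith
    have hLip : ∀ (j : ℕ) (x y : ℝ), x ≤ y →
        ap H (ap (F ^ j) y) - ap H (ap (F ^ j) x) ≤ (1 + 2 * η) ^ j * (ap H y - ap H x) := by
      intro j x y hxy
      induction j with
      | zero => simp [ap_one]
      | succ j ih =>
        rw [ap_pow_succ, ap_pow_succ, hHF, hHF, pow_succ']
        have h1 := hφ2 _ _ (ap_le (F := H).2 (ap_le (F := F ^ j).2 hxy))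
        have h2 := mul_le_mul_of_nonneg_left ih (show 0 ≤ 1 + 2 * η by linarith)
        linarith
    intro j x y hx hxy hj
    have hjx : ap (F ^ j) x ≤ x₁ := (ap_le.2 hxy).trans hj
    have c1 := hcount j x hx hjx
    have c2 := hcount j y (hx.trans hxy) hj
    have hjs : 0 ≤ (j : ℝ) * (t / (4 * D)) := by positivity
    have hbound : (1 + 2 * η) ^ j ≤ 2 := by
      have h1 : (1 + 2 * η) ^ j ≤ Real.exp (2 * η) ^ j := by
        apply pow_le_pow_left₀ (by linarith)
        linarith [Real.add_one_le_exp (2 * η)]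
      rw [← Real.exp_nat_mul] at h1
      have h2 : (j : ℝ) * (2 * η) ≤ 1 / 2 := by
        have h3 : (j : ℝ) * (t / (4 * D)) ≤ x₀ - x₃ := by linarith
        have h4 : (j : ℝ) * t ≤ (x₀ - x₃) * (4 * D) := by
          rw [← mul_div_assoc, div_le_iff₀ (by positivity)] at h3
          exact h3
        have h5 : (j : ℝ) * (16 * η * D * (x₀ - x₃)) ≤ j * t := by gcongr
        by_contra hcon
        push Not at hcon
        have h6 : 0 < (x₀ - x₃) * (4 * D) := by
          apply mul_pos <;> linarith
        have h7 : (x₀ - x₃) * (4 * D) * (1 / 2 * 2) < (x₀ - x₃) * (4 * D) * (j * (2 * η) * 2) := by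
          gcongr
        nlinarith
      have h3 : Real.exp (j * (2 * η)) ≤ Real.exp (1 / 2) := Real.exp_le_exp.2 h2
      have h4 : Real.exp (1 / 2 : ℝ) ≤ 2 := by
        have h5 : Real.exp (1 / 2 : ℝ) * Real.exp (1 / 2) = Real.exp 1 := by
          rw [← Real.exp_add]; norm_num
        have h6 := Real.exp_one_lt_d9
        by_contra hcon
        push Not at hcon
        nlinarith
      linarith
    obtain ⟨d1, -⟩ := hDl (ap (F ^ j) x) (ap (F ^ j) y) (by linarith) (ap_le.2 hxy) (by linarith)
    obtain ⟨-, d2⟩ := hDl x y (by linarith) hxy (by linarith)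
    have h1 := hLip j x y hxy
    have h2 : 0 ≤ ap H y - ap H x := sub_nonneg.2 (ap_le.2 hxy)
    have h3 : ll * (ap (F ^ j) y - ap (F ^ j) x) ≤ ll * (2 * D * D * (y - x)) := by
      calc ll * (ap (F ^ j) y - ap (F ^ j) x)
          ≤ D * (ap H (ap (F ^ j) y) - ap H (ap (F ^ j) x)) := d1
        _ ≤ D * ((1 + 2 * η) ^ j * (ap H y - ap H x)) := by gcongr
        _ ≤ D * (2 * (D * (ll * (y - x)))) := by gcongr
        _ = _ := by ring
    exact le_of_mul_le_mul_left h3 hll0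

end RotAux

namespace RotAux

/-- analytic with positive derivative -/
def An (F : CircleDeg1Liftˣ) : Prop :=
  AnalyticOnNhd ℝ (ap F) Set.univ ∧ ∀ x : ℝ, 0 < deriv (ap F) x

lemma An.diff {F : CircleDeg1Liftˣ} (h : An F) (x : ℝ) : DifferentiableAt ℝ (ap F) x :=
  (h.1 x trivial).differentiableAt

lemma An.mvt {F : CircleDeg1Liftˣ} (h : An F) {u v : ℝ} (huv : u ≤ v) :
    ∃ c ∈ Icc u v, ap F v - ap F u = deriv (ap F) c * (v - u) := by
  rcases huv.eq_or_lt with rfl | huv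
  · exact ⟨u, ⟨le_rfl, le_rfl⟩, by simp⟩
  · obtain ⟨c, hc, hc'⟩ := exists_deriv_eq_slope (ap F) huv (ap_continuous F).continuousOn
      (fun x _ => (h.diff x).differentiableWithinAt)
    refine ⟨c, Ioo_subset_Icc_self hc, ?_⟩
    rw [hc', div_mul_cancel₀]
    linarith

/-- analytic homeos that agree on a sequence of points accumulating somewhere agree. -/
lemma An.eq_one {F : CircleDeg1Liftˣ} (h : An F) {p : ℝ}
    (hfr : ∃ᶠ x in 𝓝[≠] p, ap F x = x) : F = 1 := by
  have := AnalyticOnNhd.eq_of_frequently_eq (g := fun x : ℝ => x) h.1 (fun x _ => analyticAt_id) hfr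
  exact ap_ext fun x => congrFun this x

lemma iter_mem {g : CircleDeg1Liftˣ} {p x₀ : ℝ} (hgp : ap g p = p)
    (hgx : ∀ x ∈ Ioc p x₀, ap g x < x) {x : ℝ} (hx : x ∈ Icc p x₀) (n : ℕ) :
    ap (g ^ n) x ∈ Icc p x₀ := by
  induction n with
  | zero => simpa [ap_one] using hx
  | succ n ih =>
    rw [ap_pow_succ]
    refine ⟨by conv_lhs => rw [← hgp]
               exact ap_le.2 ih.1, ?_⟩
    rcases ih.1.eq_or_lt with h | h
    · rw [← h, hgp]; linarith [hx.1, hx.2]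
    · linarith [hgx _ ⟨h, ih.2⟩, ih.2]

lemma iter_anti {g : CircleDeg1Liftˣ} {p x₀ : ℝ} (hgp : ap g p = p)
    (hgx : ∀ x ∈ Ioc p x₀, ap g x < x) {x : ℝ} (hx : x ∈ Icc p x₀) :
    Antitone (fun n : ℕ => ap (g ^ n) x) := by
  apply antitone_nat_of_succ_le
  intro n
  rw [ap_pow_succ]
  have ih := iter_mem hgp hgx hx n
  rcases ih.1.eq_or_lt with h | h
  · rw [← h, hgp]
  · exact (hgx _ ⟨h, ih.2⟩).le

lemma iter_tendsto {g : CircleDeg1Liftˣ} {p x₀ : ℝ} (hgp : ap g p = p)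
    (hgx : ∀ x ∈ Ioc p x₀, ap g x < x) {x : ℝ} (hx : x ∈ Icc p x₀) :
    Tendsto (fun n : ℕ => ap (g ^ n) x) atTop (𝓝 p) := by
  have hbdd : BddBelow (range fun n : ℕ => ap (g ^ n) x) := by
    refine ⟨p, ?_⟩
    rintro _ ⟨n, rfl⟩
    exact (iter_mem hgp hgx hx n).1
  have h1 := tendsto_atTop_ciInf (iter_anti hgp hgx hx) hbdd
  set c := ⨅ n : ℕ, ap (g ^ n) x with hc
  have h2 : Tendsto (fun n : ℕ => ap (g ^ (n + 1)) x) atTop (𝓝 c) :=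
    h1.comp (tendsto_add_atTop_nat 1)
  have h3 : Tendsto (fun n : ℕ => ap (g ^ (n + 1)) x) atTop (𝓝 (ap g c)) := by
    simp only [ap_pow_succ]
    exact ((ap_continuous g).tendsto c).comp h1
  have h4 : ap g c = c := tendsto_nhds_unique h3 h2
  have hcm : c ∈ Icc p x₀ := isClosed_Icc.mem_of_tendsto h1
    (Eventually.of_forall fun n => iter_mem hgp hgx hx n)
  rcases hcm.1.eq_or_lt with h | h
  · rwa [← h] at h1
  · exact absurd h4 (hgx c ⟨h, hcm.2⟩).ne

lemma log_deriv_lip {g : CircleDeg1Liftˣ} (h : An g) (p x₀ : ℝ) :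
    ∃ K : ℝ, 0 ≤ K ∧ ∀ u ∈ Icc p x₀, ∀ v ∈ Icc p x₀,
      deriv (ap g) v ≤ Real.exp (K * |v - u|) * deriv (ap g) u := by
  have hd : AnalyticOnNhd ℝ (deriv (ap g)) Set.univ := h.1.deriv
  set φ : ℝ → ℝ := fun x => Real.log (deriv (ap g) x) with hφ
  have hφa : AnalyticOnNhd ℝ φ Set.univ := fun x hx => (hd x hx).log (h.2 x)
  have hcont : ContinuousOn (deriv φ) (Icc p x₀) := fun x _ =>
    (hφa.deriv x trivial).continuousAt.continuousWithinAt
  obtain ⟨K, hK⟩ := isCompact_Icc.exists_bound_of_continuousOn hcont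
  refine ⟨max K 0, le_max_right _ _, ?_⟩
  intro u hu v hv
  have h1 := (convex_Icc p x₀).norm_image_sub_le_of_norm_deriv_le (f := φ) (C := max K 0)
    (fun x _ => (hφa x trivial).differentiableAt) (fun x hx => (hK x hx).trans (le_max_left _ _))
    hu hv
  rw [Real.norm_eq_abs, Real.norm_eq_abs] at h1
  have h2 := (abs_le.1 h1).2
  rw [← Real.exp_log (h.2 v), ← Real.exp_log (h.2 u), ← Real.exp_add]
  apply Real.exp_le_exp.2
  simp only [hφ] at h2
  linarith

/-- The distortion lemma. -/
lemma distortion {g : CircleDeg1Liftˣ} (h : An g) {p x₀ : ℝ} (hgp : ap g p = p) (hpx : p < x₀)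
    (hgx : ∀ x ∈ Ioc p x₀, ap g x < x) :
    ∃ (ℓ : ℕ → ℝ) (D : ℝ), 1 ≤ D ∧ (∀ l, 0 < ℓ l) ∧ ℓ 0 = 1 ∧
      Dist (fun l => g ^ l) ℓ D (ap (g ^ 3) x₀) x₀ := by
  obtain ⟨K, hK0, hK⟩ := log_deriv_lip h p x₀
  set xs : ℕ → ℝ := fun i => ap (g ^ i) x₀ with hxs
  have hx0m : x₀ ∈ Icc p x₀ := ⟨hpx.le, le_rfl⟩
  have hmem : ∀ i, xs i ∈ Icc p x₀ := fun i => iter_mem hgp hgx hx0m i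
  have hanti : Antitone xs := iter_anti hgp hgx hx0m
  set ℓ : ℕ → ℝ := fun l => ∏ i ∈ Finset.range l, deriv (ap g) (xs i) with hℓ
  set S : ℕ → ℝ := fun l => xs 0 + xs 1 + xs 2 - xs l - xs (l + 1) - xs (l + 2) with hS
  have hℓ0 : ∀ l, 0 < ℓ l := fun l => Finset.prod_pos fun i _ => h.2 _
  have hS3 : ∀ l, S l ≤ 3 * (x₀ - p) := by
    intro l
    simp only [hS]
    linarith [(hmem 0).2, (hmem 1).2, (hmem 2).2, (hmem l).1, (hmem (l+1)).1, (hmem (l+2)).1]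
  have key : ∀ (l : ℕ) (u v : ℝ), xs 3 ≤ u → u ≤ v → v ≤ x₀ →
      ℓ l * (v - u) ≤ Real.exp (K * S l) * (ap (g ^ l) v - ap (g ^ l) u) ∧
      ap (g ^ l) v - ap (g ^ l) u ≤ Real.exp (K * S l) * (ℓ l * (v - u)) := by
    intro l u v hu huv hv
    induction l with
    | zero =>
      have hz : S 0 = 0 := by simp only [hS]; ring
      rw [hz]
      simp [hℓ, ap_one]
    | succ l ih =>
      have a1 : xs (l + 3) ≤ ap (g ^ l) u := by
        simp only [hxs, pow_add, ap_mul]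
        exact ap_le.2 hu
      have a2 : ap (g ^ l) u ≤ ap (g ^ l) v := ap_le.2 huv
      have a3 : ap (g ^ l) v ≤ xs l := ap_le.2 hv
      obtain ⟨c, hc, hc'⟩ := h.mvt a2
      have hcm : c ∈ Icc p x₀ := ⟨(hmem (l+3)).1.trans (a1.trans hc.1),
        (hc.2.trans a3).trans (hmem l).2⟩
      have hdist : |xs l - c| ≤ xs l - xs (l + 3) := by
        rw [abs_of_nonneg (by linarith [hc.2])]; linarith [hc.1]
      have hSl : S (l + 1) = S l + (xs l - xs (l + 3)) := by
        simp only [hS]; ring_nf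
      have b1 : deriv (ap g) (xs l) ≤ Real.exp (K * (xs l - xs (l + 3))) * deriv (ap g) c := by
        refine (hK c hcm _ (hmem l)).trans ?_
        have := (h.2 c).le
        gcongr
      have b2 : deriv (ap g) c ≤ Real.exp (K * (xs l - xs (l + 3))) * deriv (ap g) (xs l) := by
        refine (hK _ (hmem l) c hcm).trans ?_
        have := (h.2 (xs l)).le
        rw [abs_sub_comm]
        gcongr
      rw [ap_pow_succ, ap_pow_succ, hc', hSl, mul_add, Real.exp_add]
      have hℓs : ℓ (l + 1) = ℓ l * deriv (ap g) (xs l) := Finset.prod_range_succ _ _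
      rw [hℓs]
      obtain ⟨i1, i2⟩ := ih
      set E := Real.exp (K * S l) with hE
      set E' := Real.exp (K * (xs l - xs (l + 3))) with hE'
      set w := ap (g ^ l) v - ap (g ^ l) u with hw
      have hE0 : 0 < E := Real.exp_pos _
      have hE'0 : 0 < E' := Real.exp_pos _
      have hw0 : 0 ≤ w := by linarith
      have hgl := h.2 (xs l)
      have hgc := h.2 c
      have hlv : 0 ≤ ℓ l * (v - u) := mul_nonneg (hℓ0 l).le (by linarith)
      constructor
      · calc ℓ l * deriv (ap g) (xs l) * (v - u) = (ℓ l * (v - u)) * deriv (ap g) (xs l) := by ring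
          _ ≤ (E * w) * (E' * deriv (ap g) c) := by
              apply mul_le_mul i1 b1 hgl.le; positivity
          _ = _ := by ring
      · calc deriv (ap g) c * w ≤ (E' * deriv (ap g) (xs l)) * (E * (ℓ l * (v - u))) := by
              apply mul_le_mul b2 i2 hw0; positivity
          _ = _ := by ring
  refine ⟨ℓ, Real.exp (K * (3 * (x₀ - p))), ?_, hℓ0, by simp [hℓ], ?_⟩
  · apply Real.one_le_exp
    have : 0 ≤ x₀ - p := by linarith
    positivity
  · intro l u v hu huv hv
    obtain ⟨k1, k2⟩ := key l u v hu huv hv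
    have hle : Real.exp (K * S l) ≤ Real.exp (K * (3 * (x₀ - p))) := by
      apply Real.exp_le_exp.2
      have := hS3 l
      gcongr
    have h3 : 0 ≤ ap (g ^ l) v - ap (g ^ l) u := sub_nonneg.2 (ap_le.2 huv)
    have h4 : 0 ≤ ℓ l * (v - u) := mul_nonneg (hℓ0 l).le (sub_nonneg.2 huv)
    exact ⟨k1.trans (by gcongr), k2.trans (by gcongr)⟩

end RotAux

namespace RotAux

theorem flow_exists {G : Subgroup CircleDeg1Liftˣ} (hAn : ∀ F ∈ G, An F)
    (hlip : ∀ F ∈ G, ∃ K, 0 ≤ K ∧ ∀ x y, x ≤ y → ap F y - ap F x ≤ K * (y - x))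
    (hsmall : ∀ η : ℝ, 0 < η → ∃ f ∈ G, f ≠ 1 ∧ (∀ x, |ap f x - x| < η) ∧ NearTr f η)
    {g h : CircleDeg1Liftˣ} (hg : g ∈ G) (hh : h ∈ G) {p x₀ : ℝ} (hgp : ap g p = p) (hpx : p < x₀)
    (hgx : ∀ x ∈ Ioc p x₀, ap g x < x) (hhp : ap h p ∈ Ioo (ap (g ^ 3) x₀) x₀) :
    ∃ L, 0 < L ∧ Flow G (ap (g ^ 2) x₀) (ap g x₀) L := by
  obtain ⟨ℓ, D, hD1, hℓ, hℓ0, hD⟩ := distortion (hAn g hg) hgp hpx hgx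
  have hx0m : x₀ ∈ Icc p x₀ := ⟨hpx.le, le_rfl⟩
  have hgx0 : ap g x₀ < x₀ := hgx x₀ ⟨hpx, le_rfl⟩
  have h21 : ap (g ^ 2) x₀ < ap g x₀ := by
    rw [pow_two, ap_mul]; exact ap_lt.2 hgx0
  have h32 : ap (g ^ 3) x₀ < ap (g ^ 2) x₀ := by
    rw [show (3:ℕ) = 2 + 1 from rfl, ap_pow_succ']; exact ap_lt.2 hgx0
  set x₁ := ap g x₀ with hx₁
  set x₂ := ap (g ^ 2) x₀ with hx₂
  set x₃ := ap (g ^ 3) x₀ with hx₃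
  have hpx3 : p ≤ x₃ := (iter_mem hgp hgx hx0m 3).1
  have hxm : ∀ x ∈ Icc x₃ x₀, x ∈ Icc p x₀ := fun x hx => ⟨hpx3.trans hx.1, hx.2⟩
  -- bilipschitz constant of h
  obtain ⟨Dh, hDh1, hDhu, hDhl⟩ : ∃ Dh : ℝ, 1 ≤ Dh ∧
      (∀ u v, u ≤ v → ap h v - ap h u ≤ Dh * (v - u)) ∧
      (∀ u v, u ≤ v → v - u ≤ Dh * (ap h v - ap h u)) := by
    obtain ⟨K1, hK1, hK1'⟩ := hlip h hh
    obtain ⟨K2, hK2, hK2'⟩ := hlip h⁻¹ (G.inv_mem hh)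
    refine ⟨1 + K1 + K2, by linarith, ?_, ?_⟩
    · intro u v huv
      have := hK1' u v huv
      have h0 : 0 ≤ v - u := by linarith
      nlinarith [mul_nonneg hK2 h0]
    · intro u v huv
      have h1 : ap h u ≤ ap h v := ap_le.2 huv
      have := hK2' _ _ h1
      rw [ap_inv_ap, ap_inv_ap] at this
      have h0 : 0 ≤ ap h v - ap h u := by linarith
      nlinarith [mul_nonneg hK1 h0]
  have hD0 : 0 < D := by linarith
  have hDh0 : 0 < Dh := by linarith
  set D' := D * D * Dh with hD'
  have hDD' : D ≤ D' := by
    have h1 : 1 ≤ D * Dh := by nlinarith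
    calc D = D * 1 := by ring
      _ ≤ D * (D * Dh) := by gcongr
      _ = D' := by rw [hD']; ring
  have hD'1 : 1 ≤ D' := hD1.trans hDD'
  have hD'0 : 0 < D' := by linarith
  -- m
  have hT0 := iter_tendsto hgp hgx hx0m
  obtain ⟨m, hm⟩ : ∃ m : ℕ, ap h (ap (g ^ m) x₀) < x₀ := by
    have h1 : Tendsto (fun n : ℕ => ap h (ap (g ^ n) x₀)) atTop (𝓝 (ap h p)) :=
      ((ap_continuous h).tendsto p).comp hT0
    exact (h1.eventually (gt_mem_nhds hhp.2)).exists
  -- limit of ℓ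
  have hℓlim : Tendsto ℓ atTop (𝓝 0) := by
    have hT3 := iter_tendsto hgp hgx (x := x₃) (hxm x₃ ⟨le_rfl, by linarith⟩)
    have h1 : Tendsto (fun l => D * (ap (g ^ l) x₀ - ap (g ^ l) x₃) / (x₀ - x₃)) atTop
        (𝓝 (D * (p - p) / (x₀ - x₃))) := ((hT0.sub hT3).const_mul D).div_const _
    rw [sub_self, mul_zero, zero_div] at h1
    refine squeeze_zero (fun l => (hℓ l).le) (fun l => ?_) h1
    rw [le_div_iff₀ (by linarith)]
    exact (hD l x₃ x₀ le_rfl (by linarith) le_rfl).1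
  have hq3 : x₃ < ap h p := hhp.1
  refine ⟨2 * D' * D', by positivity, ?_⟩
  intro ε hε
  set C₀ := D' * D' * (x₀ - x₂) / (x₁ - x₃) with hC₀
  have h13 : 0 < x₁ - x₃ := by linarith
  have hC₀0 : 0 ≤ C₀ := by
    apply div_nonneg _ h13.le
    have : 0 ≤ x₀ - x₂ := by linarith
    positivity
  have hC₀' : D' * D' * (x₀ - x₂) ≤ C₀ * (x₁ - x₃) := by
    rw [hC₀, div_mul_cancel₀ _ h13.ne']
  set ε' := min ε (x₀ - x₁) with hε'
  have hε'0 : 0 < ε' := lt_min hε (by linarith)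
  have hℓm := hℓ m
  set M := 1 + 2 / ℓ m with hM
  have hM0 : 0 < M := by positivity
  set t := ε' / (2 * (3 * C₀ + 1) * D' * M) with ht
  have ht0 : 0 < t := by positivity
  have htM : (3 * C₀ + 1) * (t * M) * D' = ε' / 2 := by
    rw [ht]; field_simp
  set t' := 2 * t / ℓ m with ht'
  have ht'0 : 0 < t' := by positivity
  have htb : (3 * C₀ + 1) * t * D' < ε' := by
    have h1 : t ≤ t * M := by
      have : 0 ≤ t * (2 / ℓ m) := by positivity
      rw [hM]; linarith
    have h2 : (3 * C₀ + 1) * t * D' ≤ (3 * C₀ + 1) * (t * M) * D' := by gcongr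
    linarith
  have ht'b : (3 * C₀ + 1) * t' * D' < ε' := by
    have h1 : t' ≤ t * M := by
      have : t * M = t + t' := by rw [hM, ht']; ring
      linarith
    have h2 : (3 * C₀ + 1) * t' * D' ≤ (3 * C₀ + 1) * (t * M) * D' := by gcongr
    linarith
  have h03 : 0 < x₀ - x₃ := by linarith
  set s := min t t' with hs
  have hs0 : 0 < s := lt_min ht0 ht'0
  set η := min (1 / 2) (min t (s / (16 * D' * (x₀ - x₃)))) with hη
  have hη0 : 0 < η := lt_min (by norm_num) (lt_min ht0 (by positivity))
  have hη2 : η ≤ 1 / 2 := min_le_left _ _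
  have hηt : η ≤ t := (min_le_right _ _).trans (min_le_left _ _)
  have hηs : 16 * η * D' * (x₀ - x₃) ≤ s := by
    have h1 : η ≤ s / (16 * D' * (x₀ - x₃)) := (min_le_right _ _).trans (min_le_right _ _)
    rw [le_div_iff₀ (by positivity)] at h1
    linarith
  obtain ⟨f, hf, hf1, hfd, hfη⟩ := hsmall η hη0
  have hdone : (∃ F ∈ G, (∀ x ∈ Icc x₂ x₁, x < ap F x ∧ ap F x < x + ε') ∧
      ∀ (j : ℕ) (x y : ℝ), x₂ ≤ x → x ≤ y → ap (F ^ j) y ≤ x₁ →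
        ap (F ^ j) y - ap (F ^ j) x ≤ (2 * D' * D') * (y - x)) → 
      ∃ F ∈ G, (∀ x ∈ Icc x₂ x₁, x < ap F x ∧ ap F x < x + ε) ∧
      ∀ (j : ℕ) (x y : ℝ), x₂ ≤ x → x ≤ y → ap (F ^ j) y ≤ x₁ →
        ap (F ^ j) y - ap (F ^ j) x ≤ (2 * D' * D') * (y - x) := by
    rintro ⟨F, hF, hF1, hF2⟩
    refine ⟨F, hF, fun x hx => ⟨(hF1 x hx).1, (hF1 x hx).2.trans_le ?_⟩, hF2⟩
    linarith [min_le_left ε (x₀ - x₁)]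
  apply hdone
  by_cases hA : ∃ l, t * ℓ l < |ap f (ap (g ^ l) x₀) - ap (g ^ l) x₀|
  · refine crossing_flow (P := 1) (t := t) (C₀ := C₀) (ℓ := ℓ) hf hg G.one_mem hℓ hη0.le hη2 hfη hD'1 ht0 hgx0
      ?_ hC₀' (hηs.trans (min_le_left _ _)) ?_ ?_ (min_le_right _ _) htb hε'0
    · simpa only [one_mul] using hD.weaken hDD' hℓ
    · rw [hℓ0, mul_one, ap_one]
      exact (hfd x₀).le.trans hηt
    · simpa only [one_mul] using hA
  · push Not at hA
    have hB : ∀ (k : ℕ), ∀ y ∈ Icc x₃ x₀, |ap f (ap (g ^ k) y) - ap (g ^ k) y| ≤ 2 * t * ℓ k := by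
      intro k y hy
      have h1 := (hD k y x₀ hy.1 hy.2 le_rfl).2
      have h2 := hfη (ap (g ^ k) y) (ap (g ^ k) x₀) (ap_le.2 hy.2)
      have h3 := hA k
      have hℓk := hℓ k
      have h4 : η * (ap (g ^ k) x₀ - ap (g ^ k) y) ≤ t * ℓ k := by
        calc η * (ap (g ^ k) x₀ - ap (g ^ k) y) ≤ η * (D * (ℓ k * (x₀ - y))) := by gcongr
          _ ≤ η * (D' * (ℓ k * (x₀ - x₃))) := by
            have := hy.1
            have := hy.2
            have : 0 ≤ x₀ - y := by linarith
            gcongr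
          _ = (η * D' * (x₀ - x₃)) * ℓ k := by ring
          _ ≤ t * ℓ k := by
            gcongr
            have : 0 ≤ η * D' * (x₀ - x₃) := by positivity
            linarith [min_le_left t t']
      rw [abs_le] at h2 h3 ⊢
      constructor <;> linarith [h2.1, h2.2, h3.1, h3.2]
    have hqm : ap h p ∈ Icc p x₀ := hxm _ ⟨hhp.1.le, hhp.2.le⟩
    have hqp : p < ap h p := by linarith
    have hTq := iter_tendsto hgp hgx hqm
    obtain ⟨k, hk⟩ : ∃ k : ℕ, ap f (ap (g ^ k) (ap h p)) ≠ ap (g ^ k) (ap h p) := by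
      by_contra hcon
      push Not at hcon
      apply hf1
      apply (hAn f hf).eq_one (p := p)
      have h1 : Tendsto (fun n : ℕ => ap (g ^ n) (ap h p)) atTop (𝓝[≠] p) := by
        refine tendsto_nhdsWithin_iff.2 ⟨hTq, Eventually.of_forall fun n => ?_⟩
        have h2 : ap (g ^ n) p < ap (g ^ n) (ap h p) := ap_lt.2 hqp
        have h3 : p ≤ ap (g ^ n) p := (iter_mem hgp hgx ⟨le_rfl, hpx.le⟩ n).1
        exact (h3.trans_lt h2).ne'
      exact h1.frequently (Frequently.of_forall hcon)
    have hPG : g ^ k * h * g ^ m ∈ G := G.mul_mem (G.mul_mem (G.pow_mem hg k) hh) (G.pow_mem hg m)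
    have hPap : ∀ (l : ℕ) (x : ℝ), ap (g ^ k * h * g ^ m * g ^ l) x =
        ap (g ^ k) (ap h (ap (g ^ (m + l)) x)) := by
      intro l x
      rw [mul_assoc, ← pow_add, ap_mul, ap_mul]
    have hin : ∀ (l : ℕ), ∀ x ∈ Icc x₃ x₀, ap h (ap (g ^ (m + l)) x) ∈ Icc x₃ x₀ := by
      intro l x hx
      constructor
      · exact hq3.le.trans (ap_le.2 (iter_mem hgp hgx (hxm x hx) _).1)
      · refine le_trans (ap_le.2 ?_) hm.le
        exact (ap_le.2 hx.2).trans (iter_anti hgp hgx hx0m (Nat.le_add_right m l))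
    have hℓk := hℓ k
    refine crossing_flow (P := g ^ k * h * g ^ m) (t := t') (C₀ := C₀)
      (ℓ := fun l => ℓ k * ℓ (m + l)) hf hg hPG (fun l => mul_pos hℓk (hℓ _)) hη0.le hη2 hfη hD'1 ht'0
      hgx0 ?_ hC₀' (hηs.trans (min_le_right _ _)) ?_ ?_ (min_le_right _ _) ht'b hε'0
    · intro l u v hu huv hv
      simp only [hPap]
      have hu' : u ∈ Icc x₃ x₀ := ⟨hu, huv.trans hv⟩
      have hv' : v ∈ Icc x₃ x₀ := ⟨hu.trans huv, hv⟩
      obtain ⟨a1, a2⟩ := hD (m + l) u v hu huv hv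
      simp only at a1 a2
      have hab : ap (g ^ (m + l)) u ≤ ap (g ^ (m + l)) v := ap_le.2 huv
      have iu := hin l u hu'
      have iv := hin l v hv'
      set A := ap (g ^ (m + l)) u with hA'
      set B := ap (g ^ (m + l)) v with hB'
      have b1 := hDhu A B hab
      have b2 := hDhl A B hab
      obtain ⟨c1, c2⟩ := hD k (ap h A) (ap h B) iu.1 (ap_le.2 hab) iv.2
      simp only at c1 c2
      constructor
      · calc ℓ k * ℓ (m + l) * (v - u) = ℓ k * (ℓ (m + l) * (v - u)) := by ring
          _ ≤ ℓ k * (D * (Dh * (ap h B - ap h A))) := by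
            exact mul_le_mul_of_nonneg_left (a1.trans (by gcongr)) hℓk.le
          _ = D * Dh * (ℓ k * (ap h B - ap h A)) := by ring
          _ ≤ D * Dh * (D * (ap (g ^ k) (ap h B) - ap (g ^ k) (ap h A))) := by gcongr
          _ = _ := by rw [hD']; ring
      · calc ap (g ^ k) (ap h B) - ap (g ^ k) (ap h A) ≤ D * (ℓ k * (ap h B - ap h A)) := c2
          _ ≤ D * (ℓ k * (Dh * (D * (ℓ (m + l) * (v - u))))) := by
            gcongr
            exact b1.trans (by gcongr)
          _ = _ := by rw [hD']; ring
    · have h1 := hB k _ (hin 0 x₀ ⟨by linarith, le_rfl⟩)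
      have h2 := hPap 0 x₀
      rw [pow_zero, mul_one] at h2
      rw [h2]
      refine h1.trans (le_of_eq ?_)
      rw [ht', add_zero]; field_simp
    · have h1 : Tendsto (fun l => t' * (ℓ k * ℓ (m + l))) atTop (𝓝 (t' * (ℓ k * 0))) := by
        have : Tendsto (fun l => ℓ (m + l)) atTop (𝓝 0) := by
          have := hℓlim.comp (tendsto_add_atTop_nat m)
          refine this.congr fun l => ?_
          simp [add_comm]
        exact (this.const_mul _).const_mul _
      have h2 : Tendsto (fun l => ap (g ^ k * h * g ^ m * g ^ l) x₀) atTop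
          (𝓝 (ap (g ^ k) (ap h p))) := by
        simp only [hPap]
        have h3 : Tendsto (fun l => ap (g ^ (m + l)) x₀) atTop (𝓝 p) := by
          have := hT0.comp (tendsto_add_atTop_nat m)
          refine this.congr fun l => ?_
          simp [add_comm]
        exact (((ap_continuous (g ^ k)).comp (ap_continuous h)).tendsto p).comp h3
      have h4 : Tendsto (fun l => |ap f (ap (g ^ k * h * g ^ m * g ^ l) x₀) -
          ap (g ^ k * h * g ^ m * g ^ l) x₀|) atTop
          (𝓝 |ap f (ap (g ^ k) (ap h p)) - ap (g ^ k) (ap h p)|) :=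
        ((((ap_continuous f).tendsto _).comp h2).sub h2).abs
      have h5 : t' * (ℓ k * 0) < |ap f (ap (g ^ k) (ap h p)) - ap (g ^ k) (ap h p)| := by
        rw [mul_zero, mul_zero]
        exact abs_pos.2 (sub_ne_zero.2 hk)
      exact (h1.eventually_lt h4 h5).exists

end RotAux

namespace RotAux

/-- a closed nonempty invariant set -/
def Inv (G : Subgroup CircleDeg1Liftˣ) (A : Set ℝ) : Prop :=
  IsClosed A ∧ A.Nonempty ∧ ∀ F ∈ G, ∀ x ∈ A, ap F x ∈ A

def apHomeo (F : CircleDeg1Liftˣ) : ℝ ≃ₜ ℝ where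
  toFun := ap F
  invFun := ap F⁻¹
  left_inv x := ap_inv_ap F x
  right_inv x := ap_ap_inv F x
  continuous_toFun := ap_continuous F
  continuous_invFun := ap_continuous F⁻¹

lemma Inv.image {G : Subgroup CircleDeg1Liftˣ} {A : Set ℝ} (h : Inv G A) {F : CircleDeg1Liftˣ}
    (hF : F ∈ G) : apHomeo F '' A = A := by
  apply Subset.antisymm
  · rintro _ ⟨x, hx, rfl⟩
    exact h.2.2 F hF x hx
  · intro x hx
    exact ⟨ap F⁻¹ x, h.2.2 _ (G.inv_mem hF) x hx, ap_ap_inv F x⟩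

lemma orbit_dense {G : Subgroup CircleDeg1Liftˣ} {A : Set ℝ} (h : Inv G A)
    (hmin : ∀ B, Inv G B → B ⊆ A → B = A) {x y : ℝ} (hx : x ∈ A) (hy : y ∈ A)
    {u v : ℝ} (hu : u < y) (hv : y < v) : ∃ F ∈ G, ap F x ∈ Ioo u v := by
  set O : Set ℝ := {z | ∃ F ∈ G, ap F x = z} with hO
  have hOA : O ⊆ A := by
    rintro _ ⟨F, hF, rfl⟩
    exact h.2.2 F hF x hx
  have hInv : Inv G (closure O) := by
    refine ⟨isClosed_closure, ⟨x, subset_closure ⟨1, G.one_mem, ap_one x⟩⟩, ?_⟩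
    intro F hF z hz
    have hmaps : MapsTo (ap F) O O := by
      rintro _ ⟨F', hF', rfl⟩
      exact ⟨F * F', G.mul_mem hF hF', ap_mul _ _ _⟩
    exact hmaps.closure (ap_continuous F) hz
  have heq := hmin _ hInv (h.1.closure_subset_iff.2 hOA)
  rw [← heq] at hy
  obtain ⟨z, hz, F, hF, rfl⟩ := mem_closure_iff.1 hy (Ioo u v) isOpen_Ioo ⟨hu, hv⟩
  exact ⟨F, hF, hz⟩

lemma no_isolated {G : Subgroup CircleDeg1Liftˣ} {A : Set ℝ} (h : Inv G A)
    (hmin : ∀ B, Inv G B → B ⊆ A → B = A) (hinf : (A ∩ Icc 0 1).Infinite) {x : ℝ} (hx : x ∈ A) :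
    AccPt x (𝓟 A) := by
  have hInv : Inv G (derivedSet A) := by
    refine ⟨isClosed_derivedSet A, ?_, ?_⟩
    · obtain ⟨z, -, hz⟩ := hinf.exists_accPt_of_subset_isCompact isCompact_Icc inter_subset_right
      exact ⟨z, hz.mono (principal_mono.2 inter_subset_left)⟩
    · intro F hF z hz
      rw [mem_derivedSet] at hz ⊢
      have hz2 := hz
      rw [accPt_iff_nhds] at hz ⊢
      intro U hU
      obtain ⟨y, hy, hyz⟩ := hz (ap F ⁻¹' U) ((ap_continuous F).continuousAt hU)
      exact ⟨ap F y, ⟨hy.1, h.2.2 F hF y hy.2⟩, fun he => hyz ((ap_strictMono F).injective he)⟩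
  have := hmin _ hInv ((isClosed_iff_derivedSet_subset A).1 h.1)
  rw [← this] at hx
  exact hx

lemma exists_germ {G : Subgroup CircleDeg1Liftˣ} {A : Set ℝ} {δ : ℝ} (h : Inv G A)
    (htr : ∃ T ∈ G, ∀ x, ap T x = x + 1) (hδ : 0 < δ) (hgap : ∀ F ∈ G, 0 < tau F → δ ≤ tau F)
    (hsmall : ∀ η : ℝ, 0 < η → ∃ f ∈ G, f ≠ 1 ∧ (∀ x, |ap f x - x| < η) ∧ NearTr f η)
    (hacc : ∀ x ∈ A, AccPt x (𝓟 A)) :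
    ∃ p ∈ A, ∃ g ∈ G, g ≠ 1 ∧ ap g p = p ∧ ∀ ε : ℝ, 0 < ε → ∃ x ∈ A, p < x ∧ x < p + ε := by
  by_cases hA : A = univ
  · obtain ⟨f, hf, hf1, hfd, -⟩ := hsmall (δ / 2) (by linarith)
    have t1 : tau f ≤ 0 := by
      by_contra hcon
      push Not at hcon
      have h1 := hgap f hf hcon
      have h2 : tau f ≤ δ / 2 := by
        apply CircleDeg1Lift.translationNumber_le_of_le_add
        intro x
        have := (abs_lt.1 (hfd x)).2
        rw [ap_def] at this
        linarith
      linarith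
    have hinv : tau f⁻¹ = - tau f := CircleDeg1Lift.translationNumber_units_inv f
    have t2 : 0 ≤ tau f := by
      by_contra hcon
      push Not at hcon
      have h1 := hgap f⁻¹ (G.inv_mem hf) (by rw [hinv]; linarith)
      have h2 : tau f⁻¹ ≤ δ / 2 := by
        apply CircleDeg1Lift.translationNumber_le_of_le_add
        intro x
        have := (abs_lt.1 (hfd (ap f⁻¹ x))).1
        rw [ap_ap_inv, ap_def] at this
        linarith
      linarith
    have t0 : tau f = ((0 : ℤ) : ℝ) := by push_cast; linarith
    obtain ⟨p, hp⟩ := (CircleDeg1Lift.translationNumber_eq_int_iff _ (ap_continuous f)).1 t0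
    refine ⟨p, by rw [hA]; trivial, f, hf, hf1, ?_, ?_⟩
    · rw [ap_def, hp]; simp
    · intro ε hε
      exact ⟨p + ε / 2, by rw [hA]; trivial, by linarith, by linarith⟩
  · obtain ⟨y, hy⟩ := (ne_univ_iff_exists_notMem A).1 hA
    obtain ⟨T, hT, hT1⟩ := htr
    have hTn : ∀ (n : ℕ) (x : ℝ), ap (T ^ n) x = x + n := by
      intro n x
      induction n with
      | zero => simp [ap_one]
      | succ n ih => rw [ap_pow_succ, hT1, ih]; push_cast; ring
    have hne : (A ∩ Ici y).Nonempty := by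
      obtain ⟨x, hx⟩ := h.2.1
      obtain ⟨n, hn⟩ := exists_nat_ge (y - x)
      refine ⟨ap (T ^ n) x, h.2.2 _ (G.pow_mem hT n) x hx, ?_⟩
      rw [hTn, mem_Ici]; linarith
    have hbdd : BddBelow (A ∩ Ici y) := ⟨y, fun z hz => hz.2⟩
    set b := sInf (A ∩ Ici y) with hb
    have hbm : b ∈ A ∩ Ici y := (h.1.inter isClosed_Ici).csInf_mem hne hbdd
    have hby : y < b := lt_of_le_of_ne hbm.2 (fun he => hy (he ▸ hbm.1))
    have hmin : ∀ z ∈ A, y ≤ z → b ≤ z := fun z hz hyz => csInf_le hbdd ⟨hz, hyz⟩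
    obtain ⟨f, hf, hf1, hfd, -⟩ := hsmall (b - y) (by linarith)
    have h1 : b ≤ ap f b := by
      apply hmin _ (h.2.2 f hf b hbm.1)
      linarith [(abs_lt.1 (hfd b)).1]
    have h2 : b ≤ ap f⁻¹ b := by
      apply hmin _ (h.2.2 _ (G.inv_mem hf) b hbm.1)
      have := (abs_lt.1 (hfd (ap f⁻¹ b))).2
      rw [ap_ap_inv] at this
      linarith
    have h3 : ap f b ≤ b := by
      rw [← ap_le (F := f), ap_ap_inv] at h2
      exact h2
    refine ⟨b, hbm.1, f, hf, hf1, le_antisymm h3 h1, ?_⟩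
    intro ε hε
    have ha := accPt_iff_nhds.1 (hacc b hbm.1) (Ioo y (b + ε)) (Ioo_mem_nhds hby (by linarith))
    obtain ⟨z, ⟨hz1, hz2⟩, hz3⟩ := ha
    exact ⟨z, hz2, lt_of_le_of_ne (hmin z hz2 hz1.1.le) (Ne.symm hz3), hz1.2⟩

lemma exists_germ' {G : Subgroup CircleDeg1Liftˣ} {A : Set ℝ} (hAn : ∀ F ∈ G, An F)
    {p : ℝ} {g : CircleDeg1Liftˣ} (hg : g ∈ G) (hg1 : g ≠ 1) (hgp : ap g p = p)
    (hright : ∀ ε : ℝ, 0 < ε → ∃ x ∈ A, p < x ∧ x < p + ε) :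
    ∃ g ∈ G, ap g p = p ∧ ∃ x₀ ∈ A, p < x₀ ∧ ∀ x ∈ Ioc p x₀, ap g x < x := by
  have h1 : ∀ᶠ x in 𝓝[≠] p, ap g x ≠ x := by
    by_contra hcon
    rw [Filter.not_eventually] at hcon
    simp only [not_not] at hcon
    exact hg1 ((hAn g hg).eq_one hcon)
  rw [eventually_nhdsWithin_iff, Metric.eventually_nhds_iff] at h1
  obtain ⟨ε, hε, h1⟩ := h1
  obtain ⟨x₀, hx₀A, hpx, hxε⟩ := hright ε hε
  have hne : ∀ x ∈ Ioc p x₀, ap g x ≠ x := by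
    intro x hx
    apply h1 _ hx.1.ne'
    rw [Real.dist_eq, abs_of_pos (by linarith [hx.1])]
    linarith [hx.2]
  have aux : ∀ g' : CircleDeg1Liftˣ, (∀ x ∈ Ioc p x₀, ap g' x ≠ x) → ap g' x₀ < x₀ →
      ∀ x ∈ Ioc p x₀, ap g' x < x := by
    intro g' hne' h0 x hx
    by_contra hcon
    push Not at hcon
    have hc : ContinuousOn (fun z => ap g' z - z) (Icc x x₀) :=
      ((ap_continuous g').sub continuous_id).continuousOn
    have := intermediate_value_Icc' hx.2 hc
    obtain ⟨z, hz, hz0⟩ := this ⟨show ap g' x₀ - x₀ ≤ 0 by linarith, show 0 ≤ ap g' x - x by linarith⟩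
    exact hne' z ⟨hx.1.trans_le hz.1, hz.2⟩ (by simpa [sub_eq_zero] using hz0)
  rcases lt_or_gt_of_ne (hne x₀ ⟨hpx, le_rfl⟩) with h | h
  · exact ⟨g, hg, hgp, x₀, hx₀A, hpx, aux g hne h⟩
  · have hp' : ap g⁻¹ p = p := by
      conv_lhs => rw [← hgp]
      exact ap_inv_ap g p
    refine ⟨g⁻¹, G.inv_mem hg, hp', x₀, hx₀A, hpx, aux g⁻¹ ?_ ?_⟩
    · intro x hx he
      apply hne x hx
      conv_lhs => rw [← he]
      exact ap_ap_inv g x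
    · rw [← ap_lt (F := g), ap_ap_inv]
      exact h

theorem main_contradiction {G : Subgroup CircleDeg1Liftˣ} {A : Set ℝ} {δ : ℝ}
    (hAn : ∀ F ∈ G, An F)
    (hlip : ∀ F ∈ G, ∃ K, 0 ≤ K ∧ ∀ x y, x ≤ y → ap F y - ap F x ≤ K * (y - x))
    (htr : ∃ T ∈ G, ∀ x, ap T x = x + 1) (hδ : 0 < δ) (hgap : ∀ F ∈ G, 0 < tau F → δ ≤ tau F)
    (hsmall : ∀ η : ℝ, 0 < η → ∃ f ∈ G, f ≠ 1 ∧ (∀ x, |ap f x - x| < η) ∧ NearTr f η)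
    (h : Inv G A) (hmin : ∀ B, Inv G B → B ⊆ A → B = A) (hinf : (A ∩ Icc 0 1).Infinite) :
    False := by
  obtain ⟨p, hpA, g', hg', hg1', hgp', hright⟩ := exists_germ h htr hδ hgap hsmall
    (fun x hx => no_isolated h hmin hinf hx)
  obtain ⟨g, hg, hgp, x₀, hx₀, hpx, hgx⟩ := exists_germ' hAn hg' hg1' hgp' hright
  have hgx0 : ap g x₀ < x₀ := hgx x₀ ⟨hpx, le_rfl⟩
  have h21 : ap (g ^ 2) x₀ < ap g x₀ := by
    rw [pow_two, ap_mul]; exact ap_lt.2 hgx0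
  have h32 : ap (g ^ 3) x₀ < ap (g ^ 2) x₀ := by
    rw [show (3:ℕ) = 2 + 1 from rfl, ap_pow_succ']; exact ap_lt.2 hgx0
  obtain ⟨h', hh', hhp⟩ := orbit_dense h hmin hpA (h.2.2 g hg x₀ hx₀) (h32.trans h21) hgx0
  obtain ⟨L, hL, hflow⟩ := flow_exists hAn hlip hsmall hg hh' hgp hpx hgx hhp
  -- the interval lies in A
  have hsub : Icc (ap (g ^ 2) x₀) (ap g x₀) ⊆ A := by
    intro y hy
    by_contra hyA
    have hc : IsCompact (A ∩ Icc (ap (g ^ 2) x₀) y) := isCompact_Icc.inter_left h.1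
    obtain ⟨a, ha, hmax⟩ := hc.exists_isGreatest
      ⟨ap (g ^ 2) x₀, h.2.2 _ (G.pow_mem hg 2) x₀ hx₀, le_rfl, hy.1⟩
    have hay : a < y := lt_of_le_of_ne ha.2.2 (fun he => hyA (he ▸ ha.1))
    obtain ⟨F, hF, hF1, -⟩ := hflow (y - a) (by linarith)
    obtain ⟨f1, f2⟩ := hF1 a ⟨ha.2.1, hay.le.trans hy.2⟩
    have := hmax ⟨h.2.2 F hF a ha.1, ha.2.1.trans f1.le, by linarith⟩
    linarith
  have huniv : A = univ := by
    by_contra hne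
    have hfr : (frontier A).Nonempty := by
      by_contra hcon
      rw [not_nonempty_iff_eq_empty, ← isClopen_iff_frontier_eq_empty, isClopen_iff] at hcon
      rcases hcon with hcon | hcon
      · exact h.2.1.ne_empty hcon
      · exact hne hcon
    have hInv : Inv G (frontier A) := by
      refine ⟨isClosed_frontier, hfr, ?_⟩
      intro F hF x hx
      have h1 := (apHomeo F).image_frontier A
      rw [h.image hF] at h1
      rw [← h1]
      exact ⟨x, hx, rfl⟩
    have heq := hmin _ hInv h.1.frontier_subset
    have hmid : (ap (g ^ 2) x₀ + ap g x₀) / 2 ∈ interior A := by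
      apply mem_interior_iff_mem_nhds.2
      apply mem_of_superset _ hsub
      apply Icc_mem_nhds <;> linarith
    have hmid2 := interior_subset hmid
    rw [← heq] at hmid2
    exact hmid2.2 hmid
  have hdense : ∀ x u v, u < v → ∃ F ∈ G, ap F x ∈ Ioo u v := by
    intro x u v huv
    exact orbit_dense h hmin (x := x) (y := (u + v) / 2) (by rw [huniv]; trivial)
      (by rw [huniv]; trivial) (by linarith) (by linarith)
  refine flow_contradiction hdense htr ?_ hlip hδ hgap h21 hL hflow
  intro x
  obtain ⟨F, hF, hFx⟩ := hdense x p x₀ hpx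
  refine ⟨ap F⁻¹ p, ap F⁻¹ x₀, ?_, ?_, ?_⟩
  · rw [← ap_lt (F := F), ap_ap_inv]; exact hFx.1
  · rw [← ap_lt (F := F), ap_ap_inv]; exact hFx.2
  · intro ε hε
    have hT := (iter_tendsto hgp hgx ⟨hpx.le, le_rfl⟩).sub
      (iter_tendsto hgp hgx ⟨le_rfl, hpx.le⟩)
    rw [sub_self] at hT
    obtain ⟨n, hn⟩ := (hT.eventually (gt_mem_nhds hε)).exists
    refine ⟨g ^ n * F, G.mul_mem (G.pow_mem hg n) hF, ?_⟩
    rw [ap_mul, ap_mul, ap_ap_inv, ap_ap_inv]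
    exact hn

end RotAux

namespace RotAux

lemma coe_eq_iff {a b : ℝ} : ((a : ℝ) : S1) = (b : S1) ↔ ∃ n : ℤ, b = a + n := by
  rw [eq_comm, ← sub_eq_zero, ← AddCircle.coe_sub, AddCircle.coe_eq_zero_iff]
  constructor
  · rintro ⟨n, hn⟩
    refine ⟨n, ?_⟩
    simp only [zsmul_eq_mul, mul_one] at hn
    linarith
  · rintro ⟨n, hn⟩
    refine ⟨n, ?_⟩
    simp only [zsmul_eq_mul, mul_one]
    linarith

lemma S1_surj (x : S1) : ∃ y : ℝ, (y : S1) = x := QuotientAddGroup.mk_surjective x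

/-- translation by an integer -/
def tr (n : ℤ) : CircleDeg1Liftˣ := CircleDeg1Lift.translate (Multiplicative.ofAdd (n : ℝ))

lemma ap_tr (n : ℤ) (x : ℝ) : ap (tr n) x = x + n := by
  rw [add_comm]; rfl

lemma lift_mul {F H : CircleDeg1Liftˣ} {f h : S1 ≃ₜ S1} (hF : IsLiftOf (F : CircleDeg1Lift) f)
    (hH : IsLiftOf (H : CircleDeg1Lift) h) :
    IsLiftOf ((F * H : CircleDeg1Liftˣ) : CircleDeg1Lift) (f * h) := by
  intro x
  change f (h x) = _
  rw [hH x, hF]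
  rfl

lemma lift_one : IsLiftOf ((1 : CircleDeg1Liftˣ) : CircleDeg1Lift) 1 := fun _ => rfl

lemma lift_inv {F : CircleDeg1Liftˣ} {f : S1 ≃ₜ S1} (hF : IsLiftOf (F : CircleDeg1Lift) f) :
    IsLiftOf ((F⁻¹ : CircleDeg1Liftˣ) : CircleDeg1Lift) f⁻¹ := by
  intro x
  change f.symm x = _
  rw [Homeomorph.symm_apply_eq, hF]
  exact congrArg _ (ap_ap_inv F x).symm

lemma lift_pow {F : CircleDeg1Liftˣ} {f : S1 ≃ₜ S1} (hF : IsLiftOf (F : CircleDeg1Lift) f) (n : ℕ) :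
    IsLiftOf ((F ^ n : CircleDeg1Liftˣ) : CircleDeg1Lift) (f ^ n) := by
  induction n with
  | zero => simpa using lift_one
  | succ n ih => rw [pow_succ, pow_succ]; exact lift_mul ih hF

lemma lift_tr (n : ℤ) : IsLiftOf ((tr n : CircleDeg1Liftˣ) : CircleDeg1Lift) 1 := by
  intro x
  change (x : S1) = ((ap (tr n) x : ℝ) : S1)
  rw [ap_tr, coe_eq_iff]
  exact ⟨n, rfl⟩

lemma lift_eq {F : CircleDeg1Liftˣ} {f h : S1 ≃ₜ S1} (hf : IsLiftOf (F : CircleDeg1Lift) f)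
    (hh : IsLiftOf (F : CircleDeg1Lift) h) : f = h := by
  apply Homeomorph.ext
  intro x
  obtain ⟨y, rfl⟩ := S1_surj x
  rw [hf y, hh y]

lemma lift_unique {F F' : CircleDeg1Liftˣ} {f : S1 ≃ₜ S1} (hF : IsLiftOf (F : CircleDeg1Lift) f)
    (hF' : IsLiftOf (F' : CircleDeg1Lift) f) : ∃ m : ℤ, F' = tr m * F := by
  have h1 : ∀ x : ℝ, ∃ n : ℤ, ap F' x = ap F x + n := by
    intro x
    apply coe_eq_iff.1
    exact (hF x).symm.trans (hF' x)
  choose n hn using h1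
  have hc : Continuous n := by
    rw [Int.isClosedEmbedding_coe_real.isEmbedding.continuous_iff]
    have : ((fun k : ℤ => (k : ℝ)) ∘ n) = fun x => ap F' x - ap F x := by
      funext x
      simp only [Function.comp]
      rw [hn x]; ring
    rw [this]
    exact (ap_continuous F').sub (ap_continuous F)
  refine ⟨n 0, ap_ext fun x => ?_⟩
  rw [ap_mul, ap_tr, hn x]
  have : n x = n 0 := PreconnectedSpace.constant inferInstance hc
  rw [this]

lemma tau_tr_mul (m : ℤ) (F : CircleDeg1Liftˣ) : tau (tr m * F) = tau F + m := by
  have hc : Commute (tr m : CircleDeg1Lift) (F : CircleDeg1Lift) := by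
    apply CircleDeg1Lift.ext
    intro x
    change ap (tr m) (ap F x) = ap F (ap (tr m) x)
    rw [ap_tr, ap_tr, ap_add_int]
  have h1 := CircleDeg1Lift.translationNumber_mul_of_commute hc
  have h2 : CircleDeg1Lift.translationNumber (tr m : CircleDeg1Lift) = m :=
    CircleDeg1Lift.translationNumber_translate (m : ℝ)
  rw [h2] at h1
  rw [tau, tau, Units.val_mul, h1, add_comm]

lemma rotationNumber_eq {F : CircleDeg1Liftˣ} {f : S1 ≃ₜ S1}
    (hF : IsLiftOf (F : CircleDeg1Lift) f) : rotationNumber f = ((tau F : ℝ) : S1) := by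
  have hex : ∃ F : CircleDeg1Liftˣ, IsLiftOf (F : CircleDeg1Lift) f := ⟨F, hF⟩
  rw [rotationNumber, dif_pos hex]
  obtain ⟨m, hm⟩ := lift_unique hF hex.choose_spec
  have h1 : tau hex.choose = tau F + m := by
    conv_lhs => rw [hm]
    exact tau_tr_mul m F
  change ((tau hex.choose : ℝ) : S1) = _
  rw [h1, eq_comm, coe_eq_iff]
  exact ⟨m, rfl⟩

/-- the group of all lifts -/
def liftGroup (Γ : Subgroup (S1 ≃ₜ S1)) : Subgroup CircleDeg1Liftˣ where
  carrier := {F | ∃ f ∈ Γ, IsLiftOf (F : CircleDeg1Lift) f}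
  mul_mem' := by
    rintro F H ⟨f, hf, hF⟩ ⟨h, hh, hH⟩
    exact ⟨f * h, Γ.mul_mem hf hh, lift_mul hF hH⟩
  one_mem' := ⟨1, Γ.one_mem, lift_one⟩
  inv_mem' := by
    rintro F ⟨f, hf, hF⟩
    exact ⟨f⁻¹, Γ.inv_mem hf, lift_inv hF⟩

lemma mem_liftGroup {Γ : Subgroup (S1 ≃ₜ S1)} {F : CircleDeg1Liftˣ} :
    F ∈ liftGroup Γ ↔ ∃ f ∈ Γ, IsLiftOf (F : CircleDeg1Lift) f := Iff.rfl

lemma tr_mem (Γ : Subgroup (S1 ≃ₜ S1)) (n : ℤ) : tr n ∈ liftGroup Γ :=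
  ⟨1, Γ.one_mem, lift_tr n⟩

lemma lift_An {Γ : Subgroup (S1 ≃ₜ S1)} (hΓ : ∀ f ∈ Γ, IsAnalyticDiffeo f) :
    ∀ F ∈ liftGroup Γ, An F := by
  rintro F ⟨f, hf, hF⟩
  obtain ⟨F0, hF0, ha, hd⟩ := hΓ f hf
  obtain ⟨m, hm⟩ := lift_unique hF0 hF
  have he : ap F = fun x => ap F0 x + (m : ℝ) := by
    funext x
    rw [hm, ap_mul, ap_tr]
  have ha' : AnalyticOnNhd ℝ (ap F0) univ := ha
  refine ⟨?_, ?_⟩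
  · rw [he]
    exact fun x hx => (ha' x hx).add analyticAt_const
  · intro x
    rw [he, deriv_add_const]
    exact hd x

lemma An.lip {F : CircleDeg1Liftˣ} (h : An F) :
    ∃ K, 0 ≤ K ∧ ∀ x y, x ≤ y → ap F y - ap F x ≤ K * (y - x) := by
  have hcont : ContinuousOn (deriv (ap F)) (Icc 0 1) := fun x _ =>
    (h.1.deriv x trivial).continuousAt.continuousWithinAt
  obtain ⟨K, hK⟩ := isCompact_Icc.exists_bound_of_continuousOn hcont
  have hper : ∀ x, deriv (ap F) x = deriv (ap F) (Int.fract x) := by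
    intro x
    have h1 : ap F = fun y => ap F (y - (⌊x⌋ : ℝ)) + (⌊x⌋ : ℝ) := by
      funext y
      rw [← ap_add_int, sub_add_cancel]
    conv_lhs => rw [h1]
    rw [deriv_add_const, deriv_comp_sub_const]
    rfl
  have hK' : ∀ x, deriv (ap F) x ≤ K := by
    intro x
    rw [hper]
    exact (le_abs_self _).trans (hK _ ⟨Int.fract_nonneg x, (Int.fract_lt_one x).le⟩)
  refine ⟨K, (h.2 0).le.trans (hK' 0), ?_⟩
  intro x y hxy
  obtain ⟨c, -, hc⟩ := h.mvt hxy
  rw [hc]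
  have : 0 ≤ y - x := by linarith
  have := hK' c
  gcongr

lemma exists_gap {Γ : Subgroup (S1 ≃ₜ S1)}
    (hfin : (rotationNumber '' (Γ : Set (S1 ≃ₜ S1))).Finite) :
    ∃ δ : ℝ, 0 < δ ∧ ∀ F ∈ liftGroup Γ, 0 < tau F → δ ≤ tau F := by
  haveI : Fact ((0 : ℝ) < 1) := ⟨one_pos⟩
  set R := rotationNumber '' (Γ : Set (S1 ≃ₜ S1)) with hR
  have hne : R.Nonempty := ⟨_, 1, Γ.one_mem, rfl⟩
  obtain ⟨r, hr, hmin⟩ := hfin.exists_minimalFor (fun r => ((AddCircle.equivIoc (1 : ℝ) 0 r : ℝ))) R hne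
  refine ⟨(AddCircle.equivIoc (1 : ℝ) 0 r : ℝ), (AddCircle.equivIoc (1 : ℝ) 0 r).2.1, ?_⟩
  rintro F ⟨f, hf, hF⟩ hpos
  have hmem : rotationNumber f ∈ R := ⟨f, hf, rfl⟩
  have hle : (AddCircle.equivIoc (1 : ℝ) 0 r : ℝ) ≤
      (AddCircle.equivIoc (1 : ℝ) 0 (rotationNumber f) : ℝ) := by
    rcases le_total (AddCircle.equivIoc (1 : ℝ) 0 r : ℝ)
      (AddCircle.equivIoc (1 : ℝ) 0 (rotationNumber f) : ℝ) with h | h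
    · exact h
    · exact hmin hmem h
  refine hle.trans ?_
  have h1 : (((AddCircle.equivIoc (1 : ℝ) 0 (rotationNumber f) : ℝ)) : S1) = ((tau F : ℝ) : S1) := by
    rw [← rotationNumber_eq hF]
    exact AddCircle.coe_equivIoc
  obtain ⟨n, hn⟩ := coe_eq_iff.1 h1
  have h2 := (AddCircle.equivIoc (1 : ℝ) 0 (rotationNumber f)).2
  have hn0 : 0 ≤ n := by
    by_contra hcon
    push Not at hcon
    have h3 : (n : ℝ) ≤ -1 := by exact_mod_cast Int.le_sub_one_of_lt hcon
    linarith [h2.2]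
  have : (0 : ℝ) ≤ n := by exact_mod_cast hn0
  linarith

lemma exists_small {Γ : Subgroup (S1 ≃ₜ S1)} (hΓ : ∀ f ∈ Γ, IsAnalyticDiffeo f)
    (hnd : C1Nondiscrete Γ) :
    ∀ η : ℝ, 0 < η → ∃ f ∈ liftGroup Γ, f ≠ 1 ∧ (∀ x, |ap f x - x| < η) ∧ NearTr f η := by
  intro η hη
  obtain ⟨f, F, hfF, hlim⟩ := hnd
  obtain ⟨N, hN⟩ := hlim η hη
  have hN := hN N le_rfl
  obtain ⟨h1, h2, h3⟩ := hfF N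
  have hFG : F N ∈ liftGroup Γ := ⟨f N, h1, h3⟩
  refine ⟨F N, hFG, ?_, fun x => (hN x).1, ?_⟩
  · intro he
    rw [he] at h3
    exact h2 (lift_eq h3 lift_one)
  · intro x y hxy
    obtain ⟨c, -, hc⟩ := (lift_An hΓ _ hFG).mvt hxy
    have h4 : (ap (F N) y - y) - (ap (F N) x - x) = (deriv (ap (F N)) c - 1) * (y - x) := by
      linear_combination hc
    have h0 : 0 ≤ y - x := by linarith
    rw [h4, abs_mul, abs_of_nonneg h0]
    have h5 : |deriv (ap (F N)) c - 1| ≤ η := (hN c).2.le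
    gcongr

lemma exists_min_inv {G : Subgroup CircleDeg1Liftˣ} (htr : ∀ n : ℤ, tr n ∈ G) :
    ∃ A, Inv G A ∧ ∀ B, Inv G B → B ⊆ A → B = A := by
  have hmeet : ∀ A, Inv G A → (A ∩ Icc 0 1).Nonempty := by
    intro A hA
    obtain ⟨x, hx⟩ := hA.2.1
    refine ⟨ap (tr (-⌊x⌋)) x, hA.2.2 _ (htr _) x hx, ?_⟩
    rw [ap_tr]
    push_cast
    have h1 := Int.floor_le x
    have h2 := Int.lt_floor_add_one x
    constructor <;> linarith
  obtain ⟨A, -, hA⟩ := zorn_superset_nonempty {A : Set ℝ | Inv G A} (by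
    intro c hc hchain hne
    refine ⟨⋂₀ c, ?_, fun s hs => sInter_subset_of_mem hs⟩
    refine ⟨isClosed_sInter fun s hs => (hc hs).1, ?_, ?_⟩
    · have : Nonempty ((fun s : Set ℝ => s ∩ Icc 0 1) '' c) := by
        obtain ⟨s, hs⟩ := hne
        exact ⟨⟨_, s, hs, rfl⟩⟩
      have h1 := IsCompact.nonempty_sInter_of_directed_nonempty_isCompact_isClosed
        (S := (fun s : Set ℝ => s ∩ Icc 0 1) '' c) (by
          rintro _ ⟨s, hs, rfl⟩ _ ⟨s', hs', rfl⟩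
          rcases hchain.total hs hs' with h | h
          · exact ⟨_, ⟨s, hs, rfl⟩, Subset.rfl, inter_subset_inter_left _ h⟩
          · exact ⟨_, ⟨s', hs', rfl⟩, inter_subset_inter_left _ h, Subset.rfl⟩)
        (by rintro _ ⟨s, hs, rfl⟩; exact hmeet s (hc hs))
        (by rintro _ ⟨s, hs, rfl⟩; exact isCompact_Icc.inter_left (hc hs).1)
        (by rintro _ ⟨s, hs, rfl⟩; exact (hc hs).1.inter isClosed_Icc)
      obtain ⟨x, hx⟩ := h1
      exact ⟨x, fun s hs => (hx _ ⟨s, hs, rfl⟩).1⟩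
    · intro F hF x hx s hs
      exact (hc hs).2.2 F hF x (hx s hs)) univ ⟨isClosed_univ, ⟨0, trivial⟩, fun _ _ _ _ => trivial⟩
  exact ⟨A, hA.1, fun B hB hBA => Subset.antisymm hBA (hA.2 hB hBA)⟩

theorem forward {Γ : Subgroup (S1 ≃ₜ S1)} (hΓ : ∀ f ∈ Γ, IsAnalyticDiffeo f)
    (hnd : C1Nondiscrete Γ) (hfin : (rotationNumber '' (Γ : Set (S1 ≃ₜ S1))).Finite) :
    HasFiniteOrbit Γ := by
  by_contra hno
  obtain ⟨δ, hδ, hgap⟩ := exists_gap hfin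
  obtain ⟨A, hA, hmin⟩ := exists_min_inv (tr_mem Γ)
  have hAn := lift_An hΓ
  refine main_contradiction hAn (fun F hF => (hAn F hF).lip)
    ⟨tr 1, tr_mem Γ 1, fun x => by rw [ap_tr]; norm_num⟩ hδ hgap (exists_small hΓ hnd) hA hmin ?_
  intro hf
  apply hno
  obtain ⟨x, hx⟩ := hA.2.1
  refine ⟨(x : S1), (hf.image (fun y : ℝ => (y : S1))).subset ?_⟩
  rintro _ ⟨γ, hγ, rfl⟩
  obtain ⟨F, hF, -⟩ := hΓ γ hγ
  have hFG : F ∈ liftGroup Γ := ⟨γ, hγ, hF⟩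
  have h1 : ap F x ∈ A := hA.2.2 F hFG x hx
  refine ⟨ap (tr (-⌊ap F x⌋)) (ap F x), ⟨hA.2.2 _ (tr_mem Γ _) _ h1, ?_⟩, ?_⟩
  · rw [ap_tr]
    push_cast
    have h1 := Int.floor_le (ap F x)
    have h2 := Int.lt_floor_add_one (ap F x)
    constructor <;> linarith
  · rw [hF x]
    exact coe_eq_iff.2 ⟨⌊ap F x⌋, by rw [ap_tr]; push_cast; rw [neg_add_cancel_right]; rfl⟩

theorem backward {Γ : Subgroup (S1 ≃ₜ S1)} (hΓ : ∀ f ∈ Γ, IsAnalyticDiffeo f)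
    (horb : HasFiniteOrbit Γ) : (rotationNumber '' (Γ : Set (S1 ≃ₜ S1))).Finite := by
  haveI : Fact ((0 : ℝ) < 1) := ⟨one_pos⟩
  obtain ⟨x, hx⟩ := horb
  set N := hx.toFinset.card with hN
  refine (AddCircle.finite_torsion (1 : ℝ) (Nat.factorial_pos N)).subset ?_
  rintro _ ⟨γ, hγ, rfl⟩
  have hγ' : γ ∈ Γ := hγ
  obtain ⟨F, hF, -⟩ := hΓ γ hγ'
  obtain ⟨i, hi, j, hj, hij, he⟩ := Finset.exists_ne_map_eq_of_card_lt_of_maps_to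
    (s := Finset.range (N + 1)) (t := hx.toFinset) (f := fun k => (γ ^ k) x)
    (by rw [Finset.card_range]; omega)
    (fun k _ => by
      simp only [Finset.mem_coe, Set.Finite.mem_toFinset]
      exact ⟨γ ^ k, Γ.pow_mem hγ' k, rfl⟩)
  have key : ∀ i j : ℕ, i < j → j ≤ N → (γ ^ i) x = (γ ^ j) x →
      N.factorial • rotationNumber γ = 0 := by
    intro i j hij hj he
    obtain ⟨k, rfl⟩ := Nat.exists_eq_add_of_lt hij
    obtain ⟨y, rfl⟩ := S1_surj x
    rw [add_assoc, pow_add] at he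
    have h1 : (γ ^ (k + 1)) (y : S1) = y := by
      have : (γ ^ i) ((γ ^ (k + 1)) (y : S1)) = (γ ^ i) (y : S1) := he.symm
      exact (γ ^ i).injective this
    have h2 := lift_pow hF (k + 1) y
    rw [h1] at h2
    obtain ⟨m, hm⟩ := coe_eq_iff.1 h2
    have h3 : CircleDeg1Lift.translationNumber (F : CircleDeg1Lift) = m / ((k + 1 : ℕ) : ℝ) := by
      apply CircleDeg1Lift.translationNumber_of_map_pow_eq_add_int (x := y) _ _ (Nat.succ_pos k)
      rw [← Units.val_pow_eq_pow_val]
      exact hm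
    have h4 : k + 1 ∣ N.factorial := Nat.dvd_factorial (Nat.succ_pos k) (by omega)
    obtain ⟨q, hq⟩ := h4
    rw [rotationNumber_eq hF, tau, h3, hq, ← AddCircle.coe_nsmul, AddCircle.coe_eq_zero_iff]
    refine ⟨q * m, ?_⟩
    simp only [nsmul_eq_mul, zsmul_eq_mul, mul_one]
    push_cast
    have : (k : ℝ) + 1 ≠ 0 := by positivity
    field_simp
  rw [Finset.mem_range] at hi hj
  rcases lt_or_gt_of_ne hij with h | h
  · exact key i j h (by omega) he
  · exact key j i h (by omega) he.symm

end RotAux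

/-- A subgroup of `Diff^ω₊(S¹)` which is nondiscrete in the `C¹`-topology has a
finite image under the rotation number function if and only if it has a finite orbit. -/
theorem finite_rotation_image_iff_finite_orbit_of_C1Nondiscrete
    (Γ : Subgroup (S1 ≃ₜ S1)) (hΓ : ∀ f ∈ Γ, IsAnalyticDiffeo f)
    (hnd : C1Nondiscrete Γ) :
    (rotationNumber '' (Γ : Set (S1 ≃ₜ S1))).Finite ↔ HasFiniteOrbit Γ := by
  exact ⟨RotAux.forward hΓ hnd, RotAux.backward hΓ⟩

end
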